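/- arXiv:1810.03171 — 4 statements merged into one kernel-verified Lean document; each statement's English description precedes it below -/
import Mathlib

section
/- Let s ∈ (0,1), p ∈ (1,∞), N > sp, set p*_s = Np/(N−sp), let V : ℝ^N → ℝ be continuous with inf_{ℝ^N} V > 0 and V(x) → ∞ as |x| → ∞, and fix ε > 0. Let (u_n) be a sequence with sup_n ‖u_n‖_ε < ∞ such that ∫_{B_R(0)} |u_n|^p dx → 0 as n → ∞ for every R > 0. Then ‖u_n‖_{L^r(ℝ^N)} → 0 for every r ∈ [p, p*_s). -/
open MeasureTheory Filter Topology
open scoped ENNReal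

noncomputable section

/-- Euclidean space `ℝ^N`. -/
abbrev Euc (N : ℕ) : Type := EuclideanSpace ℝ (Fin N)

/-- The `p`-th power of the Gagliardo seminorm `[u]_{s,p}^p`. -/
def gagliardoP (N : ℕ) (s p : ℝ) (u : Euc N → ℝ) : ℝ≥0∞ :=
  ∫⁻ x : Euc N, ∫⁻ y : Euc N,
    ENNReal.ofReal (|u x - u y| ^ p / ‖x - y‖ ^ ((N : ℝ) + s * p))

/-- The `p`-th power of the `L^p` norm, `‖u‖_{L^p}^p`. -/
def lpP (N : ℕ) (p : ℝ) (u : Euc N → ℝ) : ℝ≥0∞ :=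
  ∫⁻ x : Euc N, ENNReal.ofReal (|u x| ^ p)

/-- The `p`-th power of the norm `‖u‖_ε^p = [u]_{s,p}^p + ∫ V(εx)|u|^p dx`. -/
def normEpsP (N : ℕ) (s p ε : ℝ) (V : Euc N → ℝ) (u : Euc N → ℝ) : ℝ≥0∞ :=
  gagliardoP N s p u + ∫⁻ x : Euc N, ENNReal.ofReal (V (ε • x) * |u x| ^ p)


/-- Volume of the unit ball. -/
def omegaN (N : ℕ) : ℝ := (volume (Metric.ball (0 : Euc N) 1)).toReal

lemma omegaN_pos (N : ℕ) : 0 < omegaN N :=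
  ENNReal.toReal_pos (Metric.measure_ball_pos volume _ one_pos).ne' measure_ball_lt_top.ne

lemma vol_ball_eq {N : ℕ} (hN : 0 < N) (x : Euc N) {K : ℝ} (hK : 0 < K) :
    volume (Metric.ball x ((2 * K / omegaN N) ^ (1 / (N : ℝ)))) = ENNReal.ofReal (2 * K) := by
  have hω := omegaN_pos N
  have hN' : (0 : ℝ) < N := by exact_mod_cast hN
  have h0 : 0 < 2 * K / omegaN N := by positivity
  rw [Measure.addHaar_ball_of_pos volume x (by positivity)]
  have h1 : volume (Metric.ball (0 : Euc N) 1) = ENNReal.ofReal (omegaN N) := by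
    rw [omegaN, ENNReal.ofReal_toReal measure_ball_lt_top.ne]
  rw [h1, ← ENNReal.ofReal_mul (by positivity)]
  congr 1
  rw [finrank_euclideanSpace_fin, ← Real.rpow_natCast, ← Real.rpow_mul h0.le,
    one_div_mul_cancel hN'.ne', Real.rpow_one]
  field_simp

lemma weak_step {N : ℕ} {s p : ℝ} (hs0 : 0 < s) (hp : 1 < p) (hN : 0 < N)
    (u : Euc N → ℝ) (hu : Measurable u) {A K l : ℝ} (hA : 0 < A) (hK : 0 < K) (hl : 0 < l)
    (hG : gagliardoP N s p u ≤ ENNReal.ofReal A)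
    (hm : volume {x | l / 2 < |u x|} ≤ ENNReal.ofReal K) :
    volume {x | l < |u x|} ≤ ENNReal.ofReal
      (2 ^ p * (2 / omegaN N) ^ (1 + s * p / N) * A * l ^ (-p) * K ^ (s * p / N)) := by
  have hω := omegaN_pos N
  have hN' : (0 : ℝ) < N := by exact_mod_cast hN
  have h0 : 0 < 2 * K / omegaN N := by positivity
  set ρ : ℝ := (2 * K / omegaN N) ^ (1 / (N : ℝ)) with hρ
  have hρ0 : 0 < ρ := by positivity
  set c : ℝ := (l / 2) ^ p / ρ ^ ((N : ℝ) + s * p) with hc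
  have hc0 : 0 < c := by positivity
  have hT : MeasurableSet {x | l / 2 < |u x|} := measurableSet_lt measurable_const (by fun_prop)
  have hS : MeasurableSet {x | l < |u x|} := measurableSet_lt measurable_const (by fun_prop)
  have key : ∀ x ∈ {x | l < |u x|}, ENNReal.ofReal (c * K) ≤ ∫⁻ y : Euc N,
      ENNReal.ofReal (|u x - u y| ^ p / ‖x - y‖ ^ ((N : ℝ) + s * p)) := by
    intro x hx
    have hx' : l < |u x| := hx
    have hvG : ENNReal.ofReal K ≤ volume (Metric.ball x ρ \ {x | l / 2 < |u x|}) := by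
      refine le_trans ?_ le_measure_sdiff
      rw [vol_ball_eq hN x hK]
      refine le_trans ?_ (tsub_le_tsub_left hm _)
      rw [← ENNReal.ofReal_sub _ hK.le]
      apply ENNReal.ofReal_le_ofReal
      linarith
    calc ENNReal.ofReal (c * K) = ENNReal.ofReal c * ENNReal.ofReal K :=
          ENNReal.ofReal_mul hc0.le
      _ ≤ ENNReal.ofReal c * volume (Metric.ball x ρ \ {x | l / 2 < |u x|}) := by gcongr
      _ = ∫⁻ y in Metric.ball x ρ \ {x | l / 2 < |u x|}, ENNReal.ofReal c := by
          rw [setLIntegral_const]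
      _ ≤ ∫⁻ y in Metric.ball x ρ \ {x | l / 2 < |u x|},
            ENNReal.ofReal (|u x - u y| ^ p / ‖x - y‖ ^ ((N : ℝ) + s * p)) := by
          apply setLIntegral_mono' (Metric.isOpen_ball.measurableSet.diff hT)
          rintro y ⟨hy1, hy2⟩
          have hy2' : |u y| ≤ l / 2 := not_lt.mp hy2
          have hd : l / 2 ≤ |u x - u y| := by
            have := abs_sub_abs_le_abs_sub (u x) (u y)
            linarith
          have hne : x ≠ y := by
            rintro rfl
            linarith
          have hpos : 0 < ‖x - y‖ := norm_pos_iff.mpr (sub_ne_zero.mpr hne)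
          have hle : ‖x - y‖ ≤ ρ := by
            have := Metric.mem_ball'.mp hy1
            rw [dist_eq_norm] at this
            exact this.le
          apply ENNReal.ofReal_le_ofReal
          rw [hc]
          gcongr
      _ ≤ _ := setLIntegral_le_lintegral _ _
  have h1 : ENNReal.ofReal (c * K) * volume {x | l < |u x|} ≤ ENNReal.ofReal A := by
    refine le_trans ?_ hG
    rw [← setLIntegral_const]
    exact (setLIntegral_mono' hS key).trans (setLIntegral_le_lintegral _ _)
  have hcK : 0 < c * K := by positivity
  have h2 : volume {x | l < |u x|} ≤ ENNReal.ofReal (A / (c * K)) := by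
    rw [ENNReal.ofReal_div_of_pos hcK]
    rw [ENNReal.le_div_iff_mul_le (Or.inl (by simpa using hcK)) (Or.inl (by simp)), mul_comm]
    exact h1
  refine h2.trans (le_of_eq ?_)
  congr 1
  have e1 : ρ ^ ((N : ℝ) + s * p) = (2 / omegaN N) ^ (1 + s * p / N) * (K * K ^ (s * p / N)) := by
    rw [hρ, ← Real.rpow_mul h0.le]
    have : 1 / (N : ℝ) * (N + s * p) = 1 + s * p / N := by field_simp
    rw [this, show 2 * K / omegaN N = 2 / omegaN N * K by ring,
      Real.mul_rpow (by positivity) hK.le, Real.rpow_add hK, Real.rpow_one]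
  rw [hc, e1, Real.div_rpow hl.le (by norm_num), Real.rpow_neg hl.le]
  have := Real.rpow_pos_of_pos hl p
  field_simp

lemma cheb {N : ℕ} {p : ℝ} (hp : 1 < p) (u : Euc N → ℝ) (hu : Measurable u) {l : ℝ} (hl : 0 < l) :
    volume {x | l < |u x|} ≤ lpP N p u * ENNReal.ofReal (l ^ (-p)) := by
  have hlp := Real.rpow_pos_of_pos hl p
  rw [Real.rpow_neg hl.le, ENNReal.ofReal_inv_of_pos hlp, ← div_eq_mul_inv]
  rw [ENNReal.le_div_iff_mul_le (Or.inl (by simpa using hlp)) (Or.inl (by simp)), mul_comm]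
  have := mul_meas_ge_le_lintegral₀ (μ := (volume : Measure (Euc N)))
    (f := fun x => ENNReal.ofReal (|u x| ^ p)) (by fun_prop) (ENNReal.ofReal (l ^ p))
  refine le_trans ?_ this
  gcongr
  intro hx
  exact ENNReal.ofReal_le_ofReal (Real.rpow_le_rpow hl.le (le_of_lt hx) (by linarith))

lemma weak_iter {N : ℕ} {s p q : ℝ} (hs0 : 0 < s) (hp : 1 < p) (hN : 0 < N) {A : ℝ} (hA : 0 < A)
    (hq : q = p + s * p / N * q) (k : ℕ) :
    ∃ D : ℝ, 0 < D ∧ ∀ u : Euc N → ℝ, Measurable u → gagliardoP N s p u ≤ ENNReal.ofReal A →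
      lpP N p u ≤ ENNReal.ofReal A → ∀ l : ℝ, 0 < l →
      volume {x | l < |u x|} ≤ ENNReal.ofReal (D * l ^ (-(q - (q - p) * (s * p / N) ^ k))) := by
  induction k with
  | zero =>
    refine ⟨A, hA, fun u hu _ h2 l hl => (cheb hp u hu hl).trans ?_⟩
    rw [ENNReal.ofReal_mul hA.le]
    simp only [pow_zero, mul_one, sub_sub_cancel]
    gcongr
  | succ k ih =>
    obtain ⟨D, hD, h⟩ := ih
    have hω := omegaN_pos N
    have hN' : (0 : ℝ) < N := by exact_mod_cast hN
    set t := s * p / N with ht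
    set a := q - (q - p) * t ^ k with ha
    refine ⟨2 ^ p * (2 / omegaN N) ^ (1 + t) * A * (D * 2 ^ a) ^ t, by positivity,
      fun u hu h1 h2 l hl => ?_⟩
    have h3 := weak_step hs0 hp hN u hu hA (K := D * (l / 2) ^ (-a)) (by positivity) hl h1
      (h u hu h1 h2 (l / 2) (by positivity))
    refine h3.trans (le_of_eq ?_)
    congr 1
    have e : -(q - (q - p) * t ^ (k + 1)) = -p + (-a) * t := by
      rw [ha, pow_succ]
      linear_combination -hq
    rw [e, Real.rpow_add hl, Real.rpow_mul hl.le, Real.div_rpow hl.le (by norm_num),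
      Real.rpow_neg (by norm_num : (0 : ℝ) ≤ 2) a, div_inv_eq_mul,
      show D * (l ^ (-a) * 2 ^ a) = (D * 2 ^ a) * l ^ (-a) by ring,
      Real.mul_rpow (by positivity) (by positivity)]
    ring

lemma lp_tendsto {N : ℕ} {p : ℝ}
    (V : Euc N → ℝ)
    (hVcoer : Tendsto V (Filter.cocompact (Euc N)) atTop)
    (ε : ℝ) (hε : 0 < ε)
    (u : ℕ → Euc N → ℝ) {A : ℝ} (hA : 0 < A)
    (hb : ∀ n, ∫⁻ x : Euc N, ENNReal.ofReal (V (ε • x) * |u n x| ^ p) ≤ ENNReal.ofReal A)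
    (hloc : ∀ R : ℝ, 0 < R →
      Tendsto (fun n => ∫⁻ x in Metric.ball (0 : Euc N) R,
        ENNReal.ofReal (|u n x| ^ p)) atTop (nhds 0)) :
    Tendsto (fun n => lpP N p (u n)) atTop (nhds 0) := by
  rw [ENNReal.tendsto_nhds_zero]
  intro d hd
  obtain ⟨δ, hδ0, hδ⟩ : ∃ δ : ℝ, 0 < δ ∧ ENNReal.ofReal (2 * δ) ≤ d := by
    by_cases hdt : d = ⊤
    · exact ⟨1, one_pos, by simp [hdt]⟩
    · refine ⟨d.toReal / 2, half_pos (ENNReal.toReal_pos hd.ne' hdt), ?_⟩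
      rw [mul_div_cancel₀ _ two_ne_zero, ENNReal.ofReal_toReal hdt]
  have hM : 0 < A / δ := by positivity
  obtain ⟨R, hR0, hR⟩ : ∃ R : ℝ, 0 < R ∧ ∀ x : Euc N, R ≤ ‖x‖ → A / δ ≤ V (ε • x) := by
    have h1 := hVcoer.eventually (eventually_ge_atTop (A / δ))
    rw [← Metric.cobounded_eq_cocompact, ← comap_norm_atTop] at h1
    obtain ⟨S, hS, hS'⟩ := h1
    obtain ⟨r, hr⟩ := mem_atTop_sets.mp hS
    refine ⟨max 1 (r / ε), by positivity, fun x hx => hS' (hr _ ?_)⟩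
    rw [norm_smul, Real.norm_of_nonneg hε.le]
    have := (le_max_right _ _).trans hx
    rw [div_le_iff₀ hε] at this
    linarith
  have h2 := (ENNReal.tendsto_nhds_zero.mp (hloc R hR0)) (ENNReal.ofReal δ) (by simpa using hδ0)
  filter_upwards [h2] with n hn
  refine le_trans ?_ hδ
  rw [two_mul, ENNReal.ofReal_add hδ0.le hδ0.le, lpP,
    ← lintegral_add_compl _ (Metric.isOpen_ball.measurableSet : MeasurableSet (Metric.ball (0 : Euc N) R))]
  gcongr
  have h3 : ENNReal.ofReal (A / δ) * ∫⁻ x in (Metric.ball (0 : Euc N) R)ᶜ,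
      ENNReal.ofReal (|u n x| ^ p) ≤ ENNReal.ofReal A := by
    refine le_trans ?_ (hb n)
    rw [← lintegral_const_mul' _ _ (by simp)]
    refine le_trans ?_ (setLIntegral_le_lintegral (Metric.ball (0 : Euc N) R)ᶜ _)
    apply setLIntegral_mono' Metric.isOpen_ball.measurableSet.compl
    intro x hx
    rw [← ENNReal.ofReal_mul hM.le]
    apply ENNReal.ofReal_le_ofReal
    have : R ≤ ‖x‖ := by simpa using hx
    have := hR x this
    gcongr
  rw [mul_comm, ← ENNReal.le_div_iff_mul_le (Or.inl (by simpa using hM)) (Or.inl (by simp)),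
    ← ENNReal.ofReal_div_of_pos hM] at h3
  refine h3.trans (le_of_eq ?_)
  congr 1
  field_simp

lemma lr_tendsto {N : ℕ} {p r a D A : ℝ} (hp : 1 < p) (hpr : p < r) (hra : r < a)
    (u : ℕ → Euc N → ℝ) (hmeas : ∀ n, Measurable (u n)) 
    (hA : ∀ n, lpP N p (u n) ≤ ENNReal.ofReal A)
    (hL : Tendsto (fun n => lpP N p (u n)) atTop (nhds 0))
    (hD : ∀ n, ∀ l : ℝ, 0 < l → volume {x | l < |u n x|} ≤ ENNReal.ofReal (D * l ^ (-a))) :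
    Tendsto (fun n => lpP N r (u n)) atTop (nhds 0) := by
  have hr : 0 < r := by linarith
  have e : ∀ n, lpP N r (u n) = ENNReal.ofReal r * ∫⁻ t in Set.Ioi (0 : ℝ),
      volume {x | t < |u n x|} * ENNReal.ofReal (t ^ (r - 1)) := fun n =>
    lintegral_rpow_eq_lintegral_meas_lt_mul volume (ae_of_all _ fun x => abs_nonneg _)
      (by have := hmeas n; fun_prop) hr
  simp_rw [e]
  rw [show (0 : ℝ≥0∞) = ENNReal.ofReal r * 0 by simp]
  refine ENNReal.Tendsto.const_mul ?_ (Or.inr (by simp))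
  have key := tendsto_lintegral_of_dominated_convergence
    (μ := volume.restrict (Set.Ioi (0 : ℝ)))
    (F := fun n (t : ℝ) => volume {x | t < |u n x|} * ENNReal.ofReal (t ^ (r - 1)))
    (f := fun _ => 0)
    (Set.indicator (Set.Ioc (0 : ℝ) 1) (fun t => ENNReal.ofReal (A * t ^ (r - 1 - p))) +
      Set.indicator (Set.Ioi (1 : ℝ)) (fun t => ENNReal.ofReal (D * t ^ (r - 1 - a)))) ?_ ?_ ?_ ?_
  · simpa using key
  · intro n
    refine Measurable.mul ?_ (by fun_prop)
    refine Antitone.measurable fun t t' h => measure_mono fun x hx => lt_of_le_of_lt h hx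
  · intro n
    rw [EventuallyLE, ae_restrict_iff' measurableSet_Ioi]
    refine ae_of_all _ fun t ht => ?_
    have ht : (0 : ℝ) < t := ht
    by_cases h1 : t ≤ 1
    · have : t ∈ Set.Ioc (0 : ℝ) 1 := ⟨ht, h1⟩
      simp only [Pi.add_apply]
      rw [Set.indicator_of_mem this]
      refine le_trans ?_ le_self_add
      calc _ ≤ (ENNReal.ofReal A * ENNReal.ofReal (t ^ (-p))) * ENNReal.ofReal (t ^ (r - 1)) := by
            gcongr
            refine (cheb hp _ (hmeas n) ht).trans ?_
            gcongr
            exact hA n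
        _ = _ := by
            rw [mul_assoc, ← ENNReal.ofReal_mul (by positivity), ← Real.rpow_add ht,
              ← ENNReal.ofReal_mul' (by positivity)]
            ring_nf
    · have : t ∈ Set.Ioi (1 : ℝ) := not_le.mp h1
      simp only [Pi.add_apply]
      rw [Set.indicator_of_mem this]
      refine le_trans ?_ le_add_self
      calc _ ≤ ENNReal.ofReal (D * t ^ (-a)) * ENNReal.ofReal (t ^ (r - 1)) := by
            gcongr
            exact hD n t ht
        _ = _ := by
            rw [← ENNReal.ofReal_mul' (by positivity), mul_assoc, ← Real.rpow_add ht]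
            ring_nf
  · have hmi : Measurable (Set.indicator (Set.Ioc (0 : ℝ) 1)
        (fun t => ENNReal.ofReal (A * t ^ (r - 1 - p)))) :=
      Measurable.indicator (by fun_prop) measurableSet_Ioc
    simp only [Pi.add_apply]
    rw [lintegral_add_left hmi]
    refine (ENNReal.add_lt_top.mpr ⟨?_, ?_⟩).ne
    · rw [lintegral_indicator measurableSet_Ioc]
      have : IntegrableOn (fun t : ℝ => A * t ^ (r - 1 - p)) (Set.Ioc 0 1) := by
        refine Integrable.const_mul ?_ _
        have := intervalIntegral.intervalIntegrable_rpow' (a := 0) (b := 1)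
          (show -1 < r - 1 - p by linarith)
        exact (intervalIntegrable_iff_integrableOn_Ioc_of_le zero_le_one).mp this
      refine lt_of_le_of_lt (lintegral_mono' (Measure.restrict_mono_measure
        Measure.restrict_le_self _) le_rfl) (Integrable.lintegral_lt_top this)
    · rw [lintegral_indicator measurableSet_Ioi]
      have : IntegrableOn (fun t : ℝ => D * t ^ (r - 1 - a)) (Set.Ioi 1) :=
        (integrableOn_Ioi_rpow_of_lt (by linarith) one_pos).const_mul _
      refine lt_of_le_of_lt (lintegral_mono' (Measure.restrict_mono_measure
        Measure.restrict_le_self _) le_rfl) (Integrable.lintegral_lt_top this)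
  · rw [ae_restrict_iff' measurableSet_Ioi]
    refine ae_of_all _ fun t ht => ?_
    have ht : (0 : ℝ) < t := ht
    have h1 : Tendsto (fun n => lpP N p (u n) * ENNReal.ofReal (t ^ (-p)) *
        ENNReal.ofReal (t ^ (r - 1))) atTop (nhds 0) := by
      have := ENNReal.Tendsto.mul_const (ENNReal.Tendsto.mul_const hL
        (b := ENNReal.ofReal (t ^ (-p))) (Or.inr (by simp)))
        (b := ENNReal.ofReal (t ^ (r - 1))) (Or.inr (by simp))
      simpa using this
    refine tendsto_of_tendsto_of_tendsto_of_le_of_le tendsto_const_nhds h1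
      (fun _ => zero_le) (fun n => ?_)
    dsimp only
    gcongr
    exact cheb hp _ (hmeas n) ht

/-- Compact embedding under a coercive potential (Theorem 2.3): if `V(x) → ∞`
as `|x| → ∞` and the bounded sequence `(u_n)` tends to `0` in `L^p` of every ball,
then `u_n → 0` in `L^r(ℝ^N)` for every `r ∈ [p, p*_s)`. -/
theorem stmt_5 {N : ℕ} {s p : ℝ} (hs0 : 0 < s) (hs1 : s < 1) (hp : 1 < p)
    (hN : s * p < (N : ℝ))
    (V : Euc N → ℝ) (hVc : Continuous V)
    (V₀ : ℝ) (hV₀ : 0 < V₀) (hVlb : ∀ x, V₀ ≤ V x)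
    (hVcoer : Tendsto V (Filter.cocompact (Euc N)) atTop)
    (ε : ℝ) (hε : 0 < ε)
    (u : ℕ → Euc N → ℝ) (hmeas : ∀ n, Measurable (u n))
    (hbdd : (⨆ n, normEpsP N s p ε V (u n)) < ⊤)
    (hloc : ∀ R : ℝ, 0 < R →
      Tendsto (fun n => ∫⁻ x in Metric.ball (0 : Euc N) R,
        ENNReal.ofReal (|u n x| ^ p)) atTop (nhds 0)) :
    ∀ r : ℝ, p ≤ r → r < (N : ℝ) * p / ((N : ℝ) - s * p) →
      Tendsto (fun n => eLpNorm (u n) (ENNReal.ofReal r) volume) atTop (nhds 0) := by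
  have hN0 : 0 < N := by
    have : (0 : ℝ) < N := lt_trans (by positivity) hN
    exact_mod_cast this
  have hN' : (0 : ℝ) < N := by exact_mod_cast hN0
  intro r hpr hrq
  have hr : 0 < r := by linarith
  obtain ⟨B, hB⟩ : ∃ B : ℝ, ∀ n, normEpsP N s p ε V (u n) ≤ ENNReal.ofReal B :=
    ⟨_, fun n => (le_iSup (fun n => normEpsP N s p ε V (u n)) n).trans
      (ENNReal.ofReal_toReal hbdd.ne).ge⟩
  have hC : ∃ A : ℝ, 0 < A ∧ B ≤ A ∧ B / V₀ ≤ A :=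
    ⟨max 1 (max B (B / V₀)), by positivity, by simp, by simp⟩
  obtain ⟨A, hA, hBA, hBVA⟩ := hC
  have hG : ∀ n, gagliardoP N s p (u n) ≤ ENNReal.ofReal A := fun n =>
    (le_self_add.trans (hB n)).trans (ENNReal.ofReal_le_ofReal hBA)
  have hb : ∀ n, ∫⁻ x : Euc N, ENNReal.ofReal (V (ε • x) * |u n x| ^ p) ≤ ENNReal.ofReal B :=
    fun n => le_add_self.trans (hB n)
  have hLA : ∀ n, lpP N p (u n) ≤ ENNReal.ofReal A := by
    intro n
    refine le_trans ?_ (ENNReal.ofReal_le_ofReal hBVA)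
    rw [ENNReal.ofReal_div_of_pos hV₀,
      ENNReal.le_div_iff_mul_le (Or.inl (by simpa using hV₀)) (Or.inl (by simp)), mul_comm, lpP,
      ← lintegral_const_mul' _ _ (by simp)]
    refine le_trans (lintegral_mono fun x => ?_) (hb n)
    rw [← ENNReal.ofReal_mul hV₀.le]
    apply ENNReal.ofReal_le_ofReal
    have := hVlb (ε • x)
    gcongr
  have hL : Tendsto (fun n => lpP N p (u n)) atTop (nhds 0) :=
    lp_tendsto V hVcoer ε hε u hA (fun n => (hb n).trans (ENNReal.ofReal_le_ofReal hBA)) hloc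
  have hLr : Tendsto (fun n => lpP N r (u n)) atTop (nhds 0) := by
    rcases hpr.eq_or_lt with rfl | hlt
    · exact hL
    set q : ℝ := (N : ℝ) * p / ((N : ℝ) - s * p) with hqdef
    have hsub : (N : ℝ) - s * p ≠ 0 := by linarith
    have hq : q = p + s * p / N * q := by
      have h : q * (N - s * p) = N * p := div_mul_cancel₀ _ hsub
      have h' : s * p / N * N = s * p := div_mul_cancel₀ _ hN'.ne'
      apply mul_right_cancel₀ hN'.ne'
      linear_combination h - q * h'
    have ht0 : 0 ≤ s * p / N := by positivity
    have ht1 : s * p / N < 1 := by rwa [div_lt_one hN']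
    have hlim : Tendsto (fun k : ℕ => q - (q - p) * (s * p / N) ^ k) atTop (nhds q) := by
      have := ((tendsto_pow_atTop_nhds_zero_of_lt_one ht0 ht1).const_mul (q - p)).const_sub q
      simpa using this
    obtain ⟨k, hk⟩ := (hlim.eventually (lt_mem_nhds hrq)).exists
    obtain ⟨D, hD0, hD⟩ := weak_iter hs0 hp hN0 hA hq k
    exact lr_tendsto hp hlt hk u hmeas hLA hL (fun n => hD (u n) (hmeas n) (hG n) (hLA n))
  have he : ∀ n, eLpNorm (u n) (ENNReal.ofReal r) volume = lpP N r (u n) ^ (1 / r) := by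
    intro n
    rw [eLpNorm_eq_lintegral_rpow_enorm_toReal (by simpa using hr) (by simp),
      ENNReal.toReal_ofReal hr.le, lpP]
    congr 1
    refine lintegral_congr fun x => ?_
    rw [← ENNReal.ofReal_rpow_of_nonneg (abs_nonneg _) hr.le, ← Real.norm_eq_abs,
      ofReal_norm]
  simp_rw [he]
  have h1 := (ENNReal.continuous_rpow_const (y := 1 / r)).tendsto 0 |>.comp hLr
  rw [ENNReal.zero_rpow_of_pos (by positivity)] at h1
  exact h1
end
end

section
/- Let s ∈ (0,1), p ∈ (1,∞), N > sp, 0 < μ < sp, and let f satisfy (f1)–(f3). Let (u_n) ⊂ W^{s,p}(ℝ^N) be a sequence with sup_n ‖u_n‖_{s,p} < ∞ and u_n → u almost everywhere in ℝ^N (so u ∈ W^{s,p}(ℝ^N)), and set v_n = u_n − u. Then Σ(u_n) − Σ(v_n) − Σ(u) → 0 as n → ∞, where Σ(w) = (1/2) ∬_{ℝ^N×ℝ^N} F(w(x))F(w(y))/|x−y|^μ dx dy. -/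
open MeasureTheory Filter Topology
open scoped ENNReal

noncomputable section

/-- The primitive `F(t) = ∫_0^t f(τ) dτ`. -/
def Ffun (f : ℝ → ℝ) (t : ℝ) : ℝ := ∫ τ in (0:ℝ)..t, f τ

/-- The nonlocal term `Σ(u) = (1/2) ∬ F(u(x))F(u(y))/|x−y|^μ dx dy`. -/
def SigmaFun (N : ℕ) (μ : ℝ) (f : ℝ → ℝ) (u : Euc N → ℝ) : ℝ :=
  (1 / 2) * ∫ x : Euc N, ∫ y : Euc N, Ffun f (u x) * Ffun f (u y) / ‖x - y‖ ^ μ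

/-- The energy functional `J_ε(u) = (1/p)‖u‖_ε^p − Σ(u)`. -/
def Jfun (N : ℕ) (s p ε μ : ℝ) (V : Euc N → ℝ) (f : ℝ → ℝ) (u : Euc N → ℝ) : ℝ :=
  (1 / p) * (normEpsP N s p ε V u).toReal - SigmaFun N μ f u

/-- The derivative pairing `⟨J'_ε(u), v⟩`. -/
def Jderiv (N : ℕ) (s p ε μ : ℝ) (V : Euc N → ℝ) (f : ℝ → ℝ)
    (u v : Euc N → ℝ) : ℝ :=
  (∫ x : Euc N, ∫ y : Euc N,
      |u x - u y| ^ (p - 2) * (u x - u y) * (v x - v y) / ‖x - y‖ ^ ((N : ℝ) + s * p))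
  + (∫ x : Euc N, V (ε • x) * |u x| ^ (p - 2) * u x * v x)
  - (∫ x : Euc N, ∫ y : Euc N, Ffun f (u y) * f (u x) * v x / ‖x - y‖ ^ μ)

/-- The Nehari manifold `N_ε = {u : 0 < ‖u‖_ε < ∞, ⟨J'_ε(u), u⟩ = 0}`. -/
def Nehari (N : ℕ) (s p ε μ : ℝ) (V : Euc N → ℝ) (f : ℝ → ℝ) :
    Set (Euc N → ℝ) :=
  {u | 0 < normEpsP N s p ε V u ∧ normEpsP N s p ε V u < ⊤ ∧
    Jderiv N s p ε μ V f u u = 0}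

lemma sob_pointwise {N : ℕ} (hN : 0 < N) {σ p r M : ℝ} (hσ : 0 < σ) (hp : 0 < p) (hr : 0 < r)
    (hM : 0 < M) : ∃ C : ℝ, 0 < C ∧ ∀ u : Euc N → ℝ, Measurable u → lpP N r u ≤ ENNReal.ofReal M →
      ∀ x, ENNReal.ofReal (|u x| ^ (p + r * σ / N)) ≤ ENNReal.ofReal C *
        ∫⁻ y : Euc N, ENNReal.ofReal (|u x - u y| ^ p / ‖x - y‖ ^ ((N : ℝ) + σ)) := by
  have hN' : (0:ℝ) < N := by exact_mod_cast hN
  have : Nonempty (Fin N) := ⟨⟨0, hN⟩⟩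
  set ω : ℝ := (volume (Metric.ball (0 : Euc N) 1)).toReal with hω
  have hωE : volume (Metric.ball (0 : Euc N) 1) = ENNReal.ofReal ω :=
    (ENNReal.ofReal_toReal measure_ball_lt_top.ne).symm
  have hωpos : 0 < ω :=
    ENNReal.toReal_pos (Metric.measure_ball_pos volume _ one_pos).ne' measure_ball_lt_top.ne
  set b : ℝ := 2 * 2 ^ r * M / ω with hb
  have hbpos : 0 < b := by positivity
  set a : ℝ := b ^ (1 / (N:ℝ)) with ha
  have hapos : 0 < a := by positivity
  set c : ℝ := (2:ℝ) ^ (-p) * a ^ (-σ) * ω / 2 with hc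
  have hcpos : 0 < c := by positivity
  refine ⟨c⁻¹, inv_pos.2 hcpos, ?_⟩
  intro u hu hI x
  rcases (abs_nonneg (u x)).eq_or_lt with h0 | hl
  · rw [← h0, Real.zero_rpow (by positivity)]; simp
  set l := |u x| with hl_def
  set ε : ℝ := a * l ^ (-r / N) with hε
  have hεpos : 0 < ε := by positivity
  have hεN : ε ^ (N:ℝ) = b * l ^ (-r) := by
    rw [hε, Real.mul_rpow hapos.le (by positivity), ha, ← Real.rpow_mul hbpos.le,
      ← Real.rpow_mul hl.le]
    congr 1
    · rw [one_div_mul_cancel hN'.ne', Real.rpow_one]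
    · congr 1; field_simp
  have hεσ : ε ^ (-σ) = a ^ (-σ) * l ^ (r * σ / N) := by
    rw [hε, Real.mul_rpow hapos.le (by positivity), ← Real.rpow_mul hl.le]
    congr 2; field_simp
  set A : Set (Euc N) := {y | ENNReal.ofReal ((l / 2) ^ r) ≤ ENNReal.ofReal (|u y| ^ r)} with hA
  have hmeasA : MeasurableSet A := by
    apply measurableSet_le measurable_const
    exact ((continuous_abs.measurable.comp hu).pow_const r).ennreal_ofReal
  have hvA : volume A ≤ ENNReal.ofReal (ε ^ (N:ℝ) * ω / 2) := by
    have h1 := meas_ge_le_lintegral_div (μ := (volume : Measure (Euc N)))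
      (f := fun y => ENNReal.ofReal (|u y| ^ r))
      ((continuous_abs.measurable.comp hu).pow_const r).ennreal_ofReal.aemeasurable
      (ε := ENNReal.ofReal ((l / 2) ^ r)) (by simp; positivity) ENNReal.ofReal_ne_top
    refine h1.trans ((ENNReal.div_le_div_right hI _).trans ?_)
    rw [← ENNReal.ofReal_div_of_pos (by positivity)]
    apply ENNReal.ofReal_le_ofReal
    apply le_of_eq
    rw [hεN, hb, Real.div_rpow hl.le (by norm_num), Real.rpow_neg hl.le]
    field_simp
  have hvB : volume (Metric.ball x ε) = ENNReal.ofReal (ε ^ (N:ℝ) * ω) := by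
    rw [Measure.addHaar_ball_of_pos _ _ hεpos, hωE, ENNReal.ofReal_mul (by positivity)]
    simp
  set S : Set (Euc N) := (Metric.ball x ε \ A) \ {x} with hS
  have hmS : MeasurableSet S := (measurableSet_ball.diff hmeasA).diff (measurableSet_singleton x)
  have hvS : ENNReal.ofReal (ε ^ (N:ℝ) * ω / 2) ≤ volume S := by
    have h1 : volume (Metric.ball x ε \ A) - volume ({x} : Set (Euc N)) ≤ volume S :=
      le_measure_sdiff
    rw [measure_singleton, tsub_zero] at h1
    refine le_trans ?_ h1
    refine le_trans ?_ (le_measure_sdiff)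
    rw [hvB]
    refine le_trans ?_ (tsub_le_tsub_left hvA _)
    rw [← ENNReal.ofReal_sub _ (by positivity)]
    apply ENNReal.ofReal_le_ofReal
    linarith
  have hlow : ∀ y ∈ S, ENNReal.ofReal ((l / 2) ^ p / ε ^ ((N:ℝ) + σ)) ≤
      ENNReal.ofReal (|u x - u y| ^ p / ‖x - y‖ ^ ((N : ℝ) + σ)) := by
    intro y hy
    obtain ⟨⟨hyB, hyA⟩, hyx⟩ := hy
    apply ENNReal.ofReal_le_ofReal
    have hxy : 0 < ‖x - y‖ := norm_pos_iff.2 (sub_ne_zero.2 (fun h => hyx (by simp [h])))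
    have hd : ‖x - y‖ ≤ ε := by
      rw [Metric.mem_ball, dist_comm, dist_eq_norm] at hyB; exact hyB.le
    have hyl : |u y| ≤ l / 2 := by
      by_contra hcon
      push Not at hcon
      exact hyA (ENNReal.ofReal_le_ofReal (Real.rpow_le_rpow (by positivity) hcon.le hr.le))
    have hdiff : l / 2 ≤ |u x - u y| := by
      have := abs_sub_abs_le_abs_sub (u x) (u y)
      linarith
    gcongr
  have hint : ENNReal.ofReal ((l / 2) ^ p / ε ^ ((N:ℝ) + σ)) * volume S ≤
      ∫⁻ y : Euc N, ENNReal.ofReal (|u x - u y| ^ p / ‖x - y‖ ^ ((N : ℝ) + σ)) := by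
    rw [← setLIntegral_const]
    refine le_trans (setLIntegral_mono' hmS hlow) (setLIntegral_le_lintegral _ _)
  have hfin : ENNReal.ofReal (c * l ^ (p + r * σ / N)) ≤
      ∫⁻ y : Euc N, ENNReal.ofReal (|u x - u y| ^ p / ‖x - y‖ ^ ((N : ℝ) + σ)) := by
    refine le_trans (le_trans ?_ (mul_le_mul_right hvS _)) hint
    rw [← ENNReal.ofReal_mul (by positivity)]
    apply ENNReal.ofReal_le_ofReal
    apply le_of_eq
    rw [Real.rpow_add hεpos, Real.rpow_add hl, Real.div_rpow hl.le (by norm_num), hc,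
      Real.rpow_neg (by norm_num : (0:ℝ) ≤ 2)]
    have h3 : l ^ (r * σ / N) = a ^ σ * (ε ^ σ)⁻¹ := by
      rw [← Real.rpow_neg hεpos.le, hεσ, ← mul_assoc, ← Real.rpow_add hapos]; simp
    rw [h3, Real.rpow_neg hapos.le]
    field_simp
  calc ENNReal.ofReal (l ^ (p + r * σ / N))
      = ENNReal.ofReal c⁻¹ * ENNReal.ofReal (c * l ^ (p + r * σ / N)) := by
        rw [← ENNReal.ofReal_mul (by positivity), inv_mul_cancel_left₀ hcpos.ne']
    _ ≤ _ := by gcongr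

lemma sob_step {N : ℕ} (hN : 0 < N) {s p r : ℝ} (hσ : 0 < s * p) (hp : 0 < p) (hr : 0 < r)
    (M : ℝ≥0∞) (hM : M < ⊤) : ∃ C : ℝ≥0∞, C < ⊤ ∧ ∀ u : Euc N → ℝ, Measurable u → lpP N r u ≤ M →
      lpP N (p + r * (s * p) / N) u ≤ C * gagliardoP N s p u := by
  obtain ⟨C, hC, h⟩ := sob_pointwise hN (M := M.toReal + 1) hσ hp hr (by positivity)
  refine ⟨ENNReal.ofReal C, ENNReal.ofReal_lt_top, fun u hu hI => ?_⟩
  have hI' : lpP N r u ≤ ENNReal.ofReal (M.toReal + 1) := by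
    refine hI.trans ?_
    rw [ENNReal.le_ofReal_iff_toReal_le hM.ne (by positivity)]
    linarith
  unfold lpP gagliardoP
  rw [← lintegral_const_mul' _ _ ENNReal.ofReal_ne_top]
  exact lintegral_mono (h u hu hI')

lemma rpow_le_add {a p q ρ : ℝ} (ha : 0 ≤ a) (hp : 0 < p) (h1 : p ≤ q) (h2 : q ≤ ρ) :
    a ^ q ≤ a ^ p + a ^ ρ := by
  rcases ha.eq_or_lt with h | h
  · rw [← h, Real.zero_rpow (by linarith), Real.zero_rpow (by linarith),
      Real.zero_rpow (by linarith)]; simp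
  rcases le_total a 1 with h' | h'
  · have := Real.rpow_le_rpow_of_exponent_ge h h' h1
    have : 0 ≤ a ^ ρ := by positivity
    linarith
  · have := Real.rpow_le_rpow_of_exponent_le h' h2
    have : 0 ≤ a ^ p := by positivity
    linarith

lemma sobolev {N : ℕ} {s p ρ : ℝ} (hσ : 0 < s * p) (hp : 0 < p) (hN : s * p < N)
    (hρ1 : p ≤ ρ) (hρ2 : ρ * ((N:ℝ) - s * p) < p * N)
    (M : ℝ≥0∞) (hM : M < ⊤) : ∃ C : ℝ≥0∞, C < ⊤ ∧ ∀ u : Euc N → ℝ, Measurable u →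
      gagliardoP N s p u + lpP N p u ≤ M → lpP N ρ u ≤ C := by
  have hN' : (0:ℝ) < N := hσ.trans hN
  have hN0 : 0 < N := by exact_mod_cast hN'
  set κ : ℝ := s * p / N with hκ
  have hκ0 : 0 < κ := by positivity
  have hκ1 : κ < 1 := by rw [hκ, div_lt_one hN']; exact hN
  -- the iterates
  set L : ℝ := p / (1 - κ) with hL
  have hLpos : 0 < L := div_pos hp (by linarith)
  have hLfix : p + L * κ = L := by
    rw [hL]; field_simp [show (1 - κ) ≠ 0 by linarith]; ring
  have hpL : p ≤ L := by nlinarith [mul_pos hLpos hκ0]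
  have hiter : ∀ k : ℕ, ∃ C : ℝ≥0∞, C < ⊤ ∧ ∀ u : Euc N → ℝ, Measurable u →
      gagliardoP N s p u + lpP N p u ≤ M → lpP N (L - κ ^ k * (L - p)) u ≤ C := by
    intro k
    induction k with
    | zero =>
      refine ⟨M, hM, fun u _ h => ?_⟩
      simp only [pow_zero, one_mul, sub_sub_cancel]
      exact le_trans le_add_self h
    | succ k ih =>
      obtain ⟨C, hC, h⟩ := ih
      have hr : 0 < L - κ ^ k * (L - p) := by
        have : κ ^ k ≤ 1 := pow_le_one₀ hκ0.le hκ1.le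
        nlinarith
      obtain ⟨C', hC', h'⟩ := sob_step hN0 (s := s) hσ hp hr C hC
      refine ⟨C' * M, ENNReal.mul_lt_top hC' hM, fun u hu hb => ?_⟩
      have e : L - κ ^ (k+1) * (L - p) = p + (L - κ ^ k * (L - p)) * (s * p) / N := by
        rw [mul_div_assoc, ← hκ, pow_succ]; linear_combination (-1 : ℝ) * hLfix
      rw [e]
      refine (h' u hu (h u hu hb)).trans ?_
      gcongr
      exact le_trans le_self_add hb
  have hρL : ρ < L := by
    rw [hL, lt_div_iff₀ (by linarith), hκ]
    have : ρ * (1 - s * p / N) = ρ * ((N:ℝ) - s * p) / N := by field_simp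
    rw [this, div_lt_iff₀ hN']; exact hρ2
  have hlim : Tendsto (fun k : ℕ => L - κ ^ k * (L - p)) atTop (𝓝 (L - 0 * (L - p))) :=
    tendsto_const_nhds.sub ((tendsto_pow_atTop_nhds_zero_of_lt_one hκ0.le hκ1).mul_const _)
  rw [zero_mul, sub_zero] at hlim
  obtain ⟨k, hk⟩ := (hlim.eventually (lt_mem_nhds hρL)).exists
  obtain ⟨C, hC, h⟩ := hiter k
  refine ⟨M + C, ENNReal.add_lt_top.2 ⟨hM, hC⟩, fun u hu hb => ?_⟩
  refine le_trans ?_ (add_le_add (le_trans le_add_self hb) (h u hu hb))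
  unfold lpP
  rw [← lintegral_add_left]
  · apply lintegral_mono
    intro x
    simp only
    rw [← ENNReal.ofReal_add (by positivity) (by positivity)]
    exact ENNReal.ofReal_le_ofReal (rpow_le_add (abs_nonneg _) hp hρ1 hk.le)
  · exact ((continuous_abs.measurable.comp hu).pow_const p).ennreal_ofReal

lemma bl_abstract {α : Type*} [MeasurableSpace α] {m : Measure α} (A b : ℕ → α → ℝ) (M : ℝ)
    (hA : ∀ n, AEStronglyMeasurable (A n) m)
    (hlim : ∀ᵐ x ∂m, Tendsto (fun n => A n x) atTop (𝓝 0))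
    (hb : ∀ n, Integrable (b n) m) (hb0 : ∀ n x, 0 ≤ b n x) (hM : ∀ n, ∫ x, b n x ∂m ≤ M)
    (hdom : ∀ δ : ℝ, 0 < δ → ∃ k : α → ℝ, Integrable k m ∧ ∀ n x, |A n x| ≤ δ * b n x + k x) :
    (∀ n, Integrable (A n) m) ∧ Tendsto (fun n => ∫ x, |A n x| ∂m) atTop (𝓝 0) := by
  have hint : ∀ n, Integrable (A n) m := by
    obtain ⟨k, hk, h⟩ := hdom 1 one_pos
    intro n
    exact Integrable.mono' (((hb n).const_mul 1).add hk) (hA n) (ae_of_all _ (h n))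
  refine ⟨hint, ?_⟩
  have hM0 : 0 ≤ M := (integral_nonneg (hb0 0)).trans (hM 0)
  rw [Metric.tendsto_atTop]
  intro ε hε
  set δ : ℝ := ε / (2 * (M + 1)) with hδ
  have hδ0 : 0 < δ := by positivity
  have hδM : δ * M < ε / 2 := by
    rw [hδ, div_mul_eq_mul_div, div_lt_div_iff₀ (by positivity) (by norm_num)]
    nlinarith
  obtain ⟨k, hk, hkd⟩ := hdom δ hδ0
  set W : ℕ → α → ℝ := fun n x => max (|A n x| - δ * b n x) 0 with hW
  have hWint : ∀ n, Integrable (W n) m := fun n =>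
    (((hint n).abs.sub ((hb n).const_mul δ))).pos_part
  have hk0 : ∀ᵐ x ∂m, ∀ n, ‖W n x‖ ≤ |k x| := by
    refine ae_of_all _ fun x n => ?_
    rw [Real.norm_eq_abs, abs_of_nonneg (le_max_right _ _)]
    apply max_le _ (abs_nonneg _)
    have := hkd n x
    have := le_abs_self (k x)
    linarith
  have hWlim : Tendsto (fun n => ∫ x, W n x ∂m) atTop (𝓝 (∫ x, (0:ℝ) ∂m)) := by
    refine tendsto_integral_of_dominated_convergence (fun x => |k x|)
      (fun n => (hWint n).aestronglyMeasurable) hk.abs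
      (fun n => hk0.mono fun x hx => hx n) ?_
    filter_upwards [hlim] with x hx
    have h1 : Tendsto (fun n => |A n x|) atTop (𝓝 0) := by simpa using hx.abs
    refine squeeze_zero (fun n => le_max_right _ _) (fun n => ?_) h1
    apply max_le _ (abs_nonneg _)
    have := mul_nonneg hδ0.le (hb0 n x)
    linarith
  rw [integral_zero, Metric.tendsto_atTop] at hWlim
  obtain ⟨n0, hn0⟩ := hWlim (ε / 2) (by positivity)
  refine ⟨n0, fun n hn => ?_⟩
  have h1 := hn0 n hn
  rw [Real.dist_eq, sub_zero] at h1 ⊢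
  have h2 := le_abs_self (∫ x, W n x ∂m)
  rw [abs_of_nonneg (integral_nonneg fun x => abs_nonneg _)]
  have h3 : ∫ x, |A n x| ∂m ≤ ∫ x, (W n x + δ * b n x) ∂m := by
    refine integral_mono (hint n).abs ((hWint n).add ((hb n).const_mul δ)) fun x => ?_
    have : |A n x| - δ * b n x ≤ W n x := le_max_left _ _
    simp only
    linarith
  rw [integral_add (hWint n) ((hb n).const_mul δ), integral_const_mul] at h3
  have h4 : δ * ∫ x, b n x ∂m ≤ δ * M := by gcongr; exact hM n
  linarith

lemma elem_young {q : ℝ} (hq : 1 < q) {δ : ℝ} (hδ : 0 < δ) : ∃ D : ℝ, 0 ≤ D ∧ ∀ a b : ℝ, 0 ≤ a →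
    0 ≤ b → b * (a + b) ^ (q - 1) ≤ δ * a ^ q + D * b ^ q := by
  set η : ℝ := min 1 (δ / 2 ^ (q - 1)) with hη
  have hη0 : 0 < η := lt_min one_pos (by positivity)
  have hη1 : η ≤ 1 := min_le_left _ _
  have hη2 : η * 2 ^ (q - 1) ≤ δ := by
    rw [← le_div_iff₀ (by positivity)]; exact min_le_right _ _
  have hmul : ∀ x : ℝ, 0 ≤ x → x * x ^ (q - 1) = x ^ q := by
    intro x hx
    rw [← Real.rpow_one_add' hx (by linarith)]; congr 1; ring
  refine ⟨(1 / η + 1) ^ (q - 1), by positivity, fun a b ha hb => ?_⟩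
  have hq0 : 0 ≤ q - 1 := by linarith
  rcases le_total b (η * a) with h | h
  · have h1 : (a + b) ^ (q - 1) ≤ (2 * a) ^ (q - 1) := by
      apply Real.rpow_le_rpow (by positivity) _ hq0
      nlinarith
    rw [Real.mul_rpow (by norm_num) ha] at h1
    calc b * (a + b) ^ (q - 1) ≤ (η * a) * (2 ^ (q - 1) * a ^ (q - 1)) := by gcongr
      _ = (η * 2 ^ (q - 1)) * (a * a ^ (q - 1)) := by ring
      _ ≤ δ * a ^ q := by rw [hmul a ha]; gcongr
      _ ≤ _ := le_add_of_nonneg_right (by positivity)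
  · have h0 : a ≤ 1 / η * b := by
      rw [one_div_mul_eq_div, le_div_iff₀ hη0]; linarith
    have h1 : (a + b) ^ (q - 1) ≤ ((1 / η + 1) * b) ^ (q - 1) := by
      apply Real.rpow_le_rpow (by positivity) _ hq0
      linarith
    rw [Real.mul_rpow (by positivity) hb] at h1
    calc b * (a + b) ^ (q - 1) ≤ b * ((1 / η + 1) ^ (q - 1) * b ^ (q - 1)) := by gcongr
      _ = (1 / η + 1) ^ (q - 1) * (b * b ^ (q - 1)) := by ring
      _ = (1 / η + 1) ^ (q - 1) * b ^ q := by rw [hmul b hb]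
      _ ≤ _ := le_add_of_nonneg_left (by positivity)

lemma kernel_bound {N : ℕ} (hN : 0 < N) {μ t : ℝ} (hμ : 0 < μ) (ht : 1 < t)
    (hα : (N:ℝ) < t * (N - μ)) {δ : ℝ} (hδ : 0 < δ) :
    ∃ k : Euc N → ℝ, Integrable k ∧ ∀ z a, 0 ≤ a → a / ‖z‖ ^ μ ≤ δ * (a + a ^ t) + k z := by
  set R : ℝ := δ ^ (-1 / μ) with hR
  have hR0 : 0 < R := by positivity
  have hRμ : R ^ μ = δ⁻¹ := by
    rw [hR, ← Real.rpow_mul hδ.le, div_mul_cancel₀ _ hμ.ne', Real.rpow_neg_one]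
  set α : ℝ := μ * t / (t - 1) with hα'
  have ht1 : 0 < t - 1 := by linarith
  have hαN : α < N := by rw [hα', div_lt_iff₀ ht1]; nlinarith
  set D : ℝ := (1 / δ) ^ (1 / (t - 1)) with hD
  have hD0 : 0 < D := by positivity
  refine ⟨(Metric.ball (0 : Euc N) R).indicator (fun z => D * ‖z‖ ^ (-α)), ?_, ?_⟩
  · rw [integrable_indicator_iff measurableSet_ball]
    refine integrableOn_ball_of_norm_le_rpow (C := D) (α := α) ?_ ?_ ?_ ?_
    · rw [finrank_euclideanSpace_fin]; exact hN
    · simpa using hαN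
    · refine ae_of_all _ fun x => ?_
      rw [Real.norm_eq_abs, abs_of_nonneg (by positivity)]
    · exact ((measurable_norm.pow_const _).const_mul D).aestronglyMeasurable
  · intro z a ha
    have hk0 : 0 ≤ (Metric.ball (0 : Euc N) R).indicator (fun z => D * ‖z‖ ^ (-α)) z :=
      Set.indicator_nonneg (fun z _ => by positivity) z
    by_cases hz : z ∈ Metric.ball (0 : Euc N) R
    · rcases eq_or_ne z 0 with rfl | hz0
      · rw [norm_zero, Real.zero_rpow hμ.ne', div_zero]
        have : 0 ≤ δ * (a + a ^ t) := by positivity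
        linarith
      have hzp : 0 < ‖z‖ := norm_pos_iff.2 hz0
      set b : ℝ := ‖z‖ ^ (-μ) with hb
      have hb0 : 0 < b := by positivity
      have hab : a / ‖z‖ ^ μ = a * b := by rw [hb, Real.rpow_neg hzp.le]; rfl
      rw [hab]
      have hmul : a * a ^ (t - 1) = a ^ t := by
        rw [← Real.rpow_one_add' ha (by linarith)]; congr 1; ring
      rcases le_total b (δ * a ^ (t - 1)) with h | h
      · calc a * b ≤ a * (δ * a ^ (t - 1)) := by gcongr
          _ = δ * (a * a ^ (t - 1)) := by ring
          _ = δ * a ^ t := by rw [hmul]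
          _ ≤ δ * (a + a ^ t) := by gcongr; linarith
          _ ≤ _ := by linarith
      · have h1 : a ^ (t - 1) ≤ (1 / δ) * b := by
          rw [one_div_mul_eq_div, le_div_iff₀ hδ]; linarith
        have h2 : a ≤ D * b ^ (1 / (t - 1)) := by
          have := Real.rpow_le_rpow (by positivity) h1 (by positivity : 0 ≤ 1 / (t - 1))
          rw [← Real.rpow_mul ha, mul_one_div_cancel ht1.ne', Real.rpow_one,
            Real.mul_rpow (by positivity) hb0.le] at this
          exact this
        have h3 : b ^ (1 / (t - 1)) * b = ‖z‖ ^ (-α) := by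
          rw [← Real.rpow_add_one hb0.ne', hb, ← Real.rpow_mul hzp.le]
          congr 1; rw [hα']; field_simp; ring
        rw [Set.indicator_of_mem hz]
        calc a * b ≤ (D * b ^ (1 / (t - 1))) * b := by gcongr
          _ = D * ‖z‖ ^ (-α) := by rw [mul_assoc, h3]
          _ ≤ _ := le_add_of_nonneg_left (by positivity)
    · have hz' : R ≤ ‖z‖ := by simpa using hz
      have h1 : δ⁻¹ ≤ ‖z‖ ^ μ := by
        rw [← hRμ]; exact Real.rpow_le_rpow hR0.le hz' hμ.le
      have h2 : a / ‖z‖ ^ μ ≤ δ * a := by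
        rw [div_le_iff₀ (lt_of_lt_of_le (by positivity) h1)]
        calc a = δ * a * δ⁻¹ := by field_simp
          _ ≤ _ := by gcongr
      have : 0 ≤ δ * a ^ t := by positivity
      nlinarith

lemma F_diff {f : ℝ → ℝ} (hfc : Continuous f) {q₁ q₂ C : ℝ} (h1 : 1 < q₁) (h2 : 1 < q₂)
    (hC : 0 < C) (hf1 : ∀ t : ℝ, |f t| ≤ C * (|t| ^ (q₁ - 1) + |t| ^ (q₂ - 1))) (a b : ℝ) :
    |Ffun f (a + b) - Ffun f a| ≤ C * (|b| * (|a| + |b|) ^ (q₁ - 1) +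
      |b| * (|a| + |b|) ^ (q₂ - 1)) := by
  unfold Ffun
  rw [intervalIntegral.integral_interval_sub_left (hfc.intervalIntegrable _ _)
    (hfc.intervalIntegrable _ _)]
  have := intervalIntegral.norm_integral_le_of_norm_le_const (a := a) (b := a + b) (f := f)
    (C := C * ((|a| + |b|) ^ (q₁ - 1) + (|a| + |b|) ^ (q₂ - 1))) ?_
  · rw [Real.norm_eq_abs, add_sub_cancel_left] at this
    refine this.trans (le_of_eq (by ring))
  · intro τ hτ
    have hτ' : |τ| ≤ |a| + |b| := by
      have h3 := Set.uIoc_subset_uIcc hτ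
      have h4 : |τ - a| ≤ |a + b - a| := Set.abs_sub_left_of_mem_uIcc h3
      rw [add_sub_cancel_left] at h4
      have := abs_add_le (τ - a) a
      rw [sub_add_cancel] at this
      linarith
    refine (hf1 τ).trans ?_
    have : 0 ≤ q₁ - 1 := by linarith
    have : 0 ≤ q₂ - 1 := by linarith
    gcongr

/-- the control function -/
def Phi (p ρ a : ℝ) : ℝ := |a| ^ p + |a| ^ ρ

lemma Phi_nonneg (p ρ a : ℝ) : 0 ≤ Phi p ρ a := by unfold Phi; positivity

lemma F_BL {f : ℝ → ℝ} (hfc : Continuous f) {p ρ q₁ q₂ C : ℝ} (hp : 1 < p) (h1 : p ≤ q₁)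
    (h12 : q₁ ≤ q₂) (h2 : q₂ ≤ ρ)
    (hC : 0 < C) (hf1 : ∀ t : ℝ, |f t| ≤ C * (|t| ^ (q₁ - 1) + |t| ^ (q₂ - 1))) {δ : ℝ}
    (hδ : 0 < δ) : ∃ D : ℝ, 0 ≤ D ∧ ∀ a b, |Ffun f (a + b) - Ffun f a| ≤
      δ * Phi p ρ a + D * Phi p ρ b := by
  obtain ⟨D1, hD1, e1⟩ := elem_young (q := q₁) (by linarith) (δ := δ / (2 * C)) (by positivity)
  obtain ⟨D2, hD2, e2⟩ := elem_young (q := q₂) (by linarith) (δ := δ / (2 * C)) (by positivity)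
  refine ⟨C * (D1 + D2), by positivity, fun a b => ?_⟩
  refine (F_diff hfc (by linarith) (by linarith) hC hf1 a b).trans ?_
  have hPa1 : |a| ^ q₁ ≤ Phi p ρ a := rpow_le_add (abs_nonneg _) (by linarith) h1 (by linarith)
  have hPa2 : |a| ^ q₂ ≤ Phi p ρ a := rpow_le_add (abs_nonneg _) (by linarith) (by linarith) h2
  have hPb1 : |b| ^ q₁ ≤ Phi p ρ b := rpow_le_add (abs_nonneg _) (by linarith) h1 (by linarith)
  have hPb2 : |b| ^ q₂ ≤ Phi p ρ b := rpow_le_add (abs_nonneg _) (by linarith) (by linarith) h2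
  have i1 := e1 |a| |b| (abs_nonneg _) (abs_nonneg _)
  have i2 := e2 |a| |b| (abs_nonneg _) (abs_nonneg _)
  calc _ ≤ C * ((δ / (2 * C) * |a| ^ q₁ + D1 * |b| ^ q₁) +
        (δ / (2 * C) * |a| ^ q₂ + D2 * |b| ^ q₂)) := by gcongr
    _ ≤ C * ((δ / (2 * C) * Phi p ρ a + D1 * Phi p ρ b) +
        (δ / (2 * C) * Phi p ρ a + D2 * Phi p ρ b)) := by gcongr
    _ = _ := by field_simp; ring

lemma Ffun_zero (f : ℝ → ℝ) : Ffun f 0 = 0 := by simp [Ffun]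

lemma F_pow {f : ℝ → ℝ} (hfc : Continuous f) {p q₁ q₂ C t : ℝ} (hp : 1 < p) (h1 : p ≤ q₁)
    (h12 : q₁ ≤ q₂) (ht : 1 < t)
    (hC : 0 < C) (hf1 : ∀ t : ℝ, |f t| ≤ C * (|t| ^ (q₁ - 1) + |t| ^ (q₂ - 1))) :
    ∃ D : ℝ, 0 < D ∧ ∀ a, |Ffun f a| + |Ffun f a| ^ t ≤ D * Phi p (q₂ * t) a := by
  have hq2 : q₂ ≤ q₂ * t := by nlinarith
  have hq1 : q₁ ≤ q₁ * t := by nlinarith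
  have hq12 : q₁ * t ≤ q₂ * t := by nlinarith
  refine ⟨2 * C + (2 * C) ^ t * 2, by positivity, fun a => ?_⟩
  have hF : |Ffun f a| ≤ C * (|a| ^ q₁ + |a| ^ q₂) := by
    have := F_diff hfc (by linarith) (by linarith) hC hf1 0 a
    rw [zero_add, Ffun_zero, sub_zero, abs_zero, zero_add,
      ← Real.rpow_one_add' (abs_nonneg _) (by linarith),
      ← Real.rpow_one_add' (abs_nonneg _) (by linarith)] at this
    simpa using this
  have k1 : |a| ^ q₁ ≤ Phi p (q₂ * t) a :=
    rpow_le_add (abs_nonneg _) (by linarith) h1 (by linarith)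
  have k2 : |a| ^ q₂ ≤ Phi p (q₂ * t) a :=
    rpow_le_add (abs_nonneg _) (by linarith) (by linarith) hq2
  have k3 : |a| ^ (q₁ * t) ≤ Phi p (q₂ * t) a :=
    rpow_le_add (abs_nonneg _) (by linarith) (by linarith) hq12
  have k4 : |a| ^ (q₂ * t) ≤ Phi p (q₂ * t) a :=
    rpow_le_add (abs_nonneg _) (by linarith) (by linarith) le_rfl
  have hA : |Ffun f a| ≤ 2 * C * Phi p (q₂ * t) a := by nlinarith
  have hB : |Ffun f a| ^ t ≤ (2 * C) ^ t * 2 * Phi p (q₂ * t) a := by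
    have hmax : |Ffun f a| ≤ 2 * C * max (|a| ^ q₁) (|a| ^ q₂) := by
      have := le_max_left (|a| ^ q₁) (|a| ^ q₂)
      have := le_max_right (|a| ^ q₁) (|a| ^ q₂)
      nlinarith
    have hpw := Real.rpow_le_rpow (abs_nonneg _) hmax (by linarith : 0 ≤ t)
    have hm0 : 0 ≤ max (|a| ^ q₁) (|a| ^ q₂) := le_max_of_le_left (by positivity)
    rw [Real.mul_rpow (by positivity) hm0] at hpw
    have hmx : (max (|a| ^ q₁) (|a| ^ q₂)) ^ t ≤ 2 * Phi p (q₂ * t) a := by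
      have hPh := Phi_nonneg p (q₂ * t) a
      rcases max_choice (|a| ^ q₁) (|a| ^ q₂) with h | h <;> rw [h, ← Real.rpow_mul (abs_nonneg _)]
      · linarith
      · linarith
    calc _ ≤ (2 * C) ^ t * (max (|a| ^ q₁) (|a| ^ q₂)) ^ t := hpw
      _ ≤ (2 * C) ^ t * (2 * Phi p (q₂ * t) a) := by gcongr
      _ = _ := by ring
  linarith

/-- the bilinear form -/
def BB {N : ℕ} (μ : ℝ) (g h : Euc N → ℝ) : ℝ :=
  ∫ x : Euc N, ∫ y : Euc N, g x * h y / ‖x - y‖ ^ μ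

structure Good {N : ℕ} (μ D : ℝ) (h : Euc N → ℝ) : Prop where
  meas : Measurable h
  int : Integrable h
  kint : ∀ x : Euc N, Integrable (fun y => h y / ‖x - y‖ ^ μ)
  kbd : ∀ x : Euc N, ∫ y, |h y| / ‖x - y‖ ^ μ ≤ D

lemma BB_meas {N : ℕ} {μ : ℝ} {g h : Euc N → ℝ} (hg : Measurable g) (hh : Measurable h) :
    Measurable (fun z : Euc N × Euc N => g z.1 * h z.2 / ‖z.1 - z.2‖ ^ μ) := by
  have h1 : Measurable (fun z : Euc N × Euc N => ‖z.1 - z.2‖) :=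
    (continuous_fst.sub continuous_snd).norm.measurable
  exact ((hg.comp measurable_fst).mul (hh.comp measurable_snd)).div (h1.pow_const μ)

lemma BB_abs {N : ℕ} {μ : ℝ} (g h : Euc N → ℝ) (x : Euc N) :
    ∫ y, ‖g x * h y / ‖x - y‖ ^ μ‖ = |g x| * ∫ y, |h y| / ‖x - y‖ ^ μ := by
  rw [← integral_const_mul]
  congr 1; ext y
  rw [Real.norm_eq_abs, abs_div, abs_mul, abs_of_nonneg (by positivity : 0 ≤ ‖x - y‖ ^ μ)]
  ring

lemma BB_int {N : ℕ} {μ D : ℝ} {g h : Euc N → ℝ} (hg : Measurable g) (hgi : Integrable g)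
    (hh : Good μ D h) :
    Integrable (fun z : Euc N × Euc N => g z.1 * h z.2 / ‖z.1 - z.2‖ ^ μ)
      ((volume : Measure (Euc N)).prod volume) := by
  have hm := BB_meas (μ := μ) hg hh.meas
  rw [integrable_prod_iff hm.aestronglyMeasurable]
  refine ⟨ae_of_all _ fun x => ?_, ?_⟩
  · have := (hh.kint x).const_mul (g x)
    refine this.congr (ae_of_all _ fun y => ?_)
    simp only; ring
  · refine Integrable.mono' (hgi.abs.mul_const D) ?_ (ae_of_all _ fun x => ?_)
    · exact hm.norm.stronglyMeasurable.integral_prod_right.aestronglyMeasurable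
    · rw [Real.norm_eq_abs, abs_of_nonneg (integral_nonneg fun _ => norm_nonneg _)]
      simp only
      rw [BB_abs]
      gcongr
      exact hh.kbd x

lemma BB_eq {N : ℕ} {μ D : ℝ} {g h : Euc N → ℝ} (hg : Measurable g) (hgi : Integrable g)
    (hh : Good μ D h) : BB μ g h = ∫ z : Euc N × Euc N, g z.1 * h z.2 / ‖z.1 - z.2‖ ^ μ
      ∂((volume : Measure (Euc N)).prod volume) :=
  (integral_prod _ (BB_int hg hgi hh)).symm

lemma BB_bound {N : ℕ} {μ D : ℝ} {g h : Euc N → ℝ} (hg : Measurable g) (hgi : Integrable g)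
    (hh : Good μ D h) : |BB μ g h| ≤ D * ∫ x, |g x| := by
  have hI := (BB_int hg hgi hh)
  unfold BB
  rw [← Real.norm_eq_abs]
  refine (norm_integral_le_integral_norm _).trans ?_
  rw [← integral_const_mul]
  refine integral_mono hI.integral_prod_left.norm (hgi.abs.const_mul D) fun x => ?_
  simp only
  refine (norm_integral_le_integral_norm _).trans ?_
  rw [BB_abs, mul_comm]
  gcongr
  exact hh.kbd x

lemma BB_comm {N : ℕ} {μ D : ℝ} {g h : Euc N → ℝ} (hg : Measurable g) (hgi : Integrable g)
    (hh : Good μ D h) : BB μ g h = BB μ h g := by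
  unfold BB
  rw [integral_integral_swap (BB_int hg hgi hh)]
  congr 1; ext x; congr 1; ext y
  rw [norm_sub_rev]; ring

lemma BB_sub_left {N : ℕ} {μ D : ℝ} {g g' h : Euc N → ℝ} (hg : Measurable g) (hgi : Integrable g)
    (hg' : Measurable g') (hgi' : Integrable g')
    (hh : Good μ D h) : BB μ (fun x => g x - g' x) h = BB μ g h - BB μ g' h := by
  rw [BB_eq hg hgi hh, BB_eq hg' hgi' hh, BB_eq (g := fun x => g x - g' x) (hg.sub hg') (hgi.sub hgi') hh,
    ← integral_sub (BB_int hg hgi hh) (BB_int hg' hgi' hh)]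
  congr 1; ext z; ring

lemma good_F {N : ℕ} (hN : 0 < N) {μ t : ℝ} (hμ : 0 < μ) (ht : 1 < t)
    (hα : (N:ℝ) < t * (N - μ)) {f : ℝ → ℝ} (hFc : Continuous (Ffun f)) {p ρ C₁ M : ℝ}
    (hC₁ : 0 < C₁)
    (hF : ∀ a, |Ffun f a| + |Ffun f a| ^ t ≤ C₁ * Phi p ρ a) :
    ∃ D : ℝ, ∀ w : Euc N → ℝ, Measurable w → Integrable (fun x => Phi p ρ (w x)) →
      ∫ x, Phi p ρ (w x) ≤ M → Good μ D (fun x => Ffun f (w x)) := by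
  obtain ⟨k, hk, hkb⟩ := kernel_bound hN hμ ht hα one_pos
  refine ⟨C₁ * M + ∫ x, k x, fun w hw hi hM => ?_⟩
  have hm : Measurable (fun x => Ffun f (w x)) := hFc.measurable.comp hw
  have hmk : ∀ x : Euc N, Measurable (fun y => Ffun f (w y) / ‖x - y‖ ^ μ) := fun x =>
    hm.div (((continuous_const.sub continuous_id).norm.measurable).pow_const μ)
  have hb : ∀ x y : Euc N, |Ffun f (w y)| / ‖x - y‖ ^ μ ≤ C₁ * Phi p ρ (w y) + k (x - y) := by
    intro x y
    have h1 := hkb (x - y) |Ffun f (w y)| (abs_nonneg _)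
    have h2 := hF (w y)
    linarith
  have hki : ∀ x : Euc N, Integrable (fun y => k (x - y)) := fun x => hk.comp_sub_left x
  have habs : ∀ x y : Euc N, ‖Ffun f (w y) / ‖x - y‖ ^ μ‖ = |Ffun f (w y)| / ‖x - y‖ ^ μ := by
    intro x y
    rw [Real.norm_eq_abs, abs_div, abs_of_nonneg (by positivity : 0 ≤ ‖x - y‖ ^ μ)]
  have hint : ∀ x : Euc N, Integrable (fun y => Ffun f (w y) / ‖x - y‖ ^ μ) := fun x =>
    Integrable.mono' ((hi.const_mul C₁).add (hki x)) (hmk x).aestronglyMeasurable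
      (ae_of_all _ fun y => by rw [habs]; exact hb x y)
  refine ⟨hm, ?_, hint, ?_⟩
  · refine Integrable.mono' (hi.const_mul C₁) hm.aestronglyMeasurable (ae_of_all _ fun y => ?_)
    have h2 := hF (w y)
    have : 0 ≤ |Ffun f (w y)| ^ t := by positivity
    rw [Real.norm_eq_abs]; linarith
  · intro x
    have h1 : ∫ y, |Ffun f (w y)| / ‖x - y‖ ^ μ ≤ ∫ y, (C₁ * Phi p ρ (w y) + k (x - y)) := by
      refine integral_mono ?_ ((hi.const_mul C₁).add (hki x)) (hb x)
      exact (hint x).norm.congr (ae_of_all _ fun y => habs x y)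
    rw [integral_add (hi.const_mul C₁) (hki x), integral_const_mul,
      integral_sub_left_eq_self] at h1
    refine h1.trans ?_
    gcongr

lemma K_lim {N : ℕ} (hN : 0 < N) {μ t : ℝ} (hμ : 0 < μ) (ht : 1 < t)
    (hα : (N:ℝ) < t * (N - μ)) {f : ℝ → ℝ} (hFc : Continuous (Ffun f)) {p ρ C₁ M : ℝ}
    (hC₁ : 0 < C₁)
    (hF : ∀ a, |Ffun f a| + |Ffun f a| ^ t ≤ C₁ * Phi p ρ a)
    (w : ℕ → Euc N → ℝ) (hw : ∀ n, Measurable (w n))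
    (hi : ∀ n, Integrable (fun x => Phi p ρ (w n x)))
    (hM : ∀ n, ∫ x, Phi p ρ (w n x) ≤ M)
    (hlim : ∀ᵐ x, Tendsto (fun n => w n x) atTop (𝓝 0)) (x : Euc N) :
    Tendsto (fun n => ∫ y, |Ffun f (w n y) / ‖x - y‖ ^ μ|) atTop (𝓝 0) := by
  refine (bl_abstract (fun n y => Ffun f (w n y) / ‖x - y‖ ^ μ) (fun n y => Phi p ρ (w n y)) M
    ?_ ?_ hi (fun n y => Phi_nonneg _ _ _) hM ?_).2
  · intro n
    exact ((hFc.measurable.comp (hw n)).div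
      (((continuous_const.sub continuous_id).norm.measurable).pow_const μ)).aestronglyMeasurable
  · filter_upwards [hlim] with y hy
    have h1 : Tendsto (fun n => Ffun f (w n y)) atTop (𝓝 (Ffun f 0)) :=
      (hFc.tendsto 0).comp hy
    rw [Ffun_zero] at h1
    simpa using h1.div_const (‖x - y‖ ^ μ)
  · intro δ hδ
    obtain ⟨k, hk, hkb⟩ := kernel_bound hN hμ ht hα (δ := δ / C₁) (by positivity)
    refine ⟨fun y => k (x - y), hk.comp_sub_left x, fun n y => ?_⟩
    rw [abs_div, abs_of_nonneg (by positivity : 0 ≤ ‖x - y‖ ^ μ)]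
    refine (hkb (x - y) |Ffun f (w n y)| (abs_nonneg _)).trans ?_
    have h2 := mul_le_mul_of_nonneg_left (hF (w n y)) (by positivity : 0 ≤ δ / C₁)
    have h3 : δ / C₁ * (C₁ * Phi p ρ (w n y)) = δ * Phi p ρ (w n y) := by field_simp
    linarith

lemma BB_lim {N : ℕ} {μ D : ℝ} {g : Euc N → ℝ} (hg : Measurable g) (hgi : Integrable g)
    (h : ℕ → Euc N → ℝ) (hh : ∀ n, Good μ D (h n))
    (hlim : ∀ x : Euc N, Tendsto (fun n => ∫ y, |h n y / ‖x - y‖ ^ μ|) atTop (𝓝 0)) :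
    Tendsto (fun n => BB μ g (h n)) atTop (𝓝 0) := by
  have h0 : (0:ℝ) = ∫ x : Euc N, (0:ℝ) := by simp
  rw [h0]
  unfold BB
  refine tendsto_integral_of_dominated_convergence (fun x => D * |g x|)
    (fun n => (BB_int hg hgi (hh n)).integral_prod_left.aestronglyMeasurable)
    (hgi.abs.const_mul D) (fun n => ae_of_all _ fun x => ?_) (ae_of_all _ fun x => ?_)
  · refine (norm_integral_le_integral_norm _).trans ?_
    rw [BB_abs, mul_comm]
    gcongr
    exact (hh n).kbd x
  · refine squeeze_zero_norm (fun n => norm_integral_le_integral_norm _) ?_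
    have := (hlim x).const_mul |g x|
    rw [mul_zero] at this
    refine this.congr fun n => ?_
    rw [BB_abs]
    congr 2; ext y
    rw [abs_div, abs_of_nonneg (by positivity : 0 ≤ ‖x - y‖ ^ μ)]

lemma Phi_int {N : ℕ} {p ρ : ℝ} {w : Euc N → ℝ} (hw : Measurable w)
    {A B : ℝ≥0∞} (hA : A < ⊤) (hB : B < ⊤) (h1 : lpP N p w ≤ A) (h2 : lpP N ρ w ≤ B) :
    Integrable (fun x => Phi p ρ (w x)) ∧ ∫ x, Phi p ρ (w x) ≤ A.toReal + B.toReal := by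
  have key : ∀ (q : ℝ) (A : ℝ≥0∞), A < ⊤ → lpP N q w ≤ A → Integrable (fun x => |w x| ^ q) ∧
      ∫ x, |w x| ^ q ≤ A.toReal := by
    intro q A hA h
    have hm : Measurable (fun x => |w x| ^ q) := (continuous_abs.measurable.comp hw).pow_const q
    have h0 : 0 ≤ᵐ[volume] (fun x => |w x| ^ q) := ae_of_all _ fun x => by
      simp only [Pi.zero_apply]; positivity
    refine ⟨⟨hm.aestronglyMeasurable, ?_⟩, ?_⟩
    · rw [hasFiniteIntegral_iff_ofReal h0]
      exact lt_of_le_of_lt h hA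
    · rw [integral_eq_lintegral_of_nonneg_ae h0 hm.aestronglyMeasurable]
      exact ENNReal.toReal_mono hA.ne h
  obtain ⟨i1, b1⟩ := key p A hA h1
  obtain ⟨i2, b2⟩ := key ρ B hB h2
  unfold Phi
  refine ⟨i1.add i2, ?_⟩
  rw [integral_add i1 i2]
  linarith

lemma Phi_sub {p ρ : ℝ} (hp : 0 < p) (hρ : p ≤ ρ) (a b : ℝ) :
    Phi p ρ (a - b) ≤ 2 ^ ρ * (Phi p ρ a + Phi p ρ b) := by
  have key : ∀ q : ℝ, 0 < q → q ≤ ρ → |a - b| ^ q ≤ 2 ^ ρ * (|a| ^ q + |b| ^ q) := by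
    intro q hq hqρ
    have h1 : |a - b| ≤ 2 * max |a| |b| := by
      have := abs_sub a b
      have := le_max_left |a| |b|
      have := le_max_right |a| |b|
      linarith
    have hm0 : 0 ≤ max |a| |b| := le_max_of_le_left (abs_nonneg _)
    have h2 := Real.rpow_le_rpow (abs_nonneg _) h1 hq.le
    rw [Real.mul_rpow (by norm_num) hm0] at h2
    have h3 : (max |a| |b|) ^ q ≤ |a| ^ q + |b| ^ q := by
      have : 0 ≤ |a| ^ q := by positivity
      have : 0 ≤ |b| ^ q := by positivity
      rcases max_choice |a| |b| with h | h <;> rw [h] <;> linarith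
    refine h2.trans ?_
    gcongr
    norm_num
  have h1 := key p hp hρ
  have h2 := key ρ (by linarith) le_rfl
  unfold Phi
  linarith

/-- Brezis–Lieb type splitting for the nonlocal term (Lemma 2.5):
`Σ(u_n) − Σ(u_n − u) − Σ(u) → 0`. -/
theorem stmt_6 {N : ℕ} {s p : ℝ} (hs0 : 0 < s) (hs1 : s < 1) (hp : 1 < p)
    (hN : s * p < (N : ℝ))
    (μ : ℝ) (hμ0 : 0 < μ) (hμ : μ < s * p)
    (f : ℝ → ℝ) (hfc : Continuous f) (hf0 : ∀ t ≤ (0 : ℝ), f t = 0)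
    (q₁ q₂ C : ℝ) (hq₁ : p < q₁) (hq₁₂ : q₁ ≤ q₂)
    (hq₂ : q₂ < p * ((N : ℝ) - μ) / ((N : ℝ) - s * p)) (hCpos : 0 < C)
    (hf1 : ∀ t : ℝ, |f t| ≤ C * (|t| ^ (q₁ - 1) + |t| ^ (q₂ - 1)))
    (θ : ℝ) (hθ : p < θ)
    (hf2 : ∀ t : ℝ, 0 < t → 0 < θ * Ffun f t ∧ θ * Ffun f t ≤ 2 * f t * t)
    (hf3 : StrictMonoOn (fun t : ℝ => f t / t ^ (p / 2 - 1)) (Set.Ioi 0))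
    (u : ℕ → Euc N → ℝ) (hmeas : ∀ n, Measurable (u n))
    (hbdd : (⨆ n, gagliardoP N s p (u n) + lpP N p (u n)) < ⊤)
    (v : Euc N → ℝ) (hvmeas : Measurable v)
    (hvG : gagliardoP N s p v < ⊤) (hvLp : lpP N p v < ⊤)
    (hae : ∀ᵐ x : Euc N ∂volume, Tendsto (fun n => u n x) atTop (nhds (v x))) :
    Tendsto (fun n => SigmaFun N μ f (u n)
        - SigmaFun N μ f (fun x => u n x - v x) - SigmaFun N μ f v)
      atTop (nhds 0) := by
  have hσ : 0 < s * p := by nlinarith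
  have hp0 : 0 < p := by linarith
  have hNr : (0:ℝ) < N := hσ.trans hN
  have hN0 : 0 < N := by exact_mod_cast hNr
  have hNμ : 0 < (N:ℝ) - μ := by linarith
  have hNs : 0 < (N:ℝ) - s * p := by linarith
  have hq20 : 0 < q₂ := by linarith
  -- choice of the exponent
  obtain ⟨t, ht1, ht2⟩ : ∃ t : ℝ, (N:ℝ) / (N - μ) < t ∧ t < p * N / (q₂ * (N - s * p)) := by
    apply exists_between
    rw [lt_div_iff₀ hNs] at hq₂
    rw [div_lt_div_iff₀ hNμ (by positivity)]
    nlinarith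
  rw [div_lt_iff₀ hNμ] at ht1
  rw [lt_div_iff₀ (by positivity)] at ht2
  have ht : 1 < t := by
    by_contra hcon
    push Not at hcon
    nlinarith
  set ρ : ℝ := q₂ * t with hρ
  have hq2ρ : q₂ ≤ ρ := by nlinarith
  have hpρ : p ≤ ρ := by linarith
  have hρ2 : ρ * ((N:ℝ) - s * p) < p * N := by rw [hρ]; nlinarith
  have hFc : Continuous (Ffun f) :=
    intervalIntegral.continuous_primitive (fun a b => hfc.intervalIntegrable a b) 0
  obtain ⟨C₁, hC₁, hF⟩ := F_pow hfc hp hq₁.le hq₁₂ ht hCpos hf1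
  rw [← hρ] at hF
  -- uniform bounds
  obtain ⟨Cu, hCu, hsob⟩ := sobolev hσ hp0 hN hpρ hρ2 _ hbdd
  obtain ⟨Cv, hCv, hsobv⟩ := sobolev hσ hp0 hN hpρ hρ2 _ (ENNReal.add_lt_top.2 ⟨hvG, hvLp⟩)
  have hun : ∀ n, gagliardoP N s p (u n) + lpP N p (u n) ≤
      ⨆ n, gagliardoP N s p (u n) + lpP N p (u n) := fun n =>
    le_iSup (fun n => gagliardoP N s p (u n) + lpP N p (u n)) n
  have hPu := fun n => Phi_int (p := p) (ρ := ρ) (hmeas n) hbdd hCu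
    (le_trans le_add_self (hun n)) (hsob _ (hmeas n) (hun n))
  have hPv := Phi_int (p := p) (ρ := ρ) hvmeas hvLp hCv le_rfl (hsobv _ hvmeas le_rfl)
  set Mu := (⨆ n, gagliardoP N s p (u n) + lpP N p (u n)).toReal + Cu.toReal with hMu
  set Mv := (lpP N p v).toReal + Cv.toReal with hMv
  have hmd : ∀ n, Measurable (fun x => u n x - v x) := fun n => (hmeas n).sub hvmeas
  have hPd : ∀ n, Integrable (fun x => Phi p ρ (u n x - v x)) ∧
      ∫ x, Phi p ρ (u n x - v x) ≤ 2 ^ ρ * (Mu + Mv) := by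
    intro n
    have hI : Integrable (fun x => 2 ^ ρ * (Phi p ρ (u n x) + Phi p ρ (v x))) :=
      ((hPu n).1.add hPv.1).const_mul _
    have hmP : Measurable (fun x => Phi p ρ (u n x - v x)) := by
      unfold Phi
      exact ((continuous_abs.measurable.comp (hmd n)).pow_const p).add
        ((continuous_abs.measurable.comp (hmd n)).pow_const ρ)
    have hI2 : Integrable (fun x => Phi p ρ (u n x - v x)) :=
      hI.mono' hmP.aestronglyMeasurable (ae_of_all _ fun x => by
        rw [Real.norm_eq_abs, abs_of_nonneg (Phi_nonneg _ _ _)]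
        exact Phi_sub hp0 hpρ _ _)
    refine ⟨hI2, (integral_mono hI2 hI fun x => Phi_sub hp0 hpρ _ _).trans ?_⟩
    rw [integral_const_mul, integral_add (hPu n).1 hPv.1]
    have := (hPu n).2
    have := hPv.2
    gcongr
  set M₀ : ℝ := max (max Mu Mv) (2 ^ ρ * (Mu + Mv)) with hM₀
  obtain ⟨D, hD⟩ := good_F (N := N) (M := M₀) hN0 hμ0 ht ht1 hFc hC₁ hF
  have gU : ∀ n, Good μ D (fun x => Ffun f (u n x)) := fun n =>
    hD _ (hmeas n) (hPu n).1 ((hPu n).2.trans ((le_max_left _ _).trans (le_max_left _ _)))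
  have gV : Good μ D (fun x => Ffun f (v x)) :=
    hD _ hvmeas hPv.1 (hPv.2.trans ((le_max_right _ _).trans (le_max_left _ _)))
  have gD : ∀ n, Good μ D (fun x => Ffun f (u n x - v x)) := fun n =>
    hD _ (hmd n) (hPd n).1 ((hPd n).2.trans (le_max_right _ _))
  have hd0 : ∀ᵐ x : Euc N, Tendsto (fun n => u n x - v x) atTop (𝓝 0) := by
    filter_upwards [hae] with x hx
    simpa using hx.sub_const (v x)
  -- cross term
  have hcross : Tendsto (fun n => BB μ (fun x => Ffun f (v x)) (fun x => Ffun f (u n x - v x)))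
      atTop (𝓝 0) :=
    BB_lim gV.meas gV.int _ gD fun x => K_lim hN0 hμ0 ht ht1 hFc hC₁ hF
      (fun n x => u n x - v x) hmd (fun n => (hPd n).1) (fun n => (hPd n).2) hd0 x
  -- remainder
  set R : ℕ → Euc N → ℝ := fun n x => Ffun f (u n x) - Ffun f (u n x - v x) - Ffun f (v x) with hR
  have hRm : ∀ n, Measurable (R n) := fun n => ((gU n).meas.sub (gD n).meas).sub gV.meas
  have hRi : ∀ n, Integrable (R n) := fun n => ((gU n).int.sub (gD n).int).sub gV.int
  have hRlim : Tendsto (fun n => ∫ x, |R n x|) atTop (𝓝 0) := by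
    refine (bl_abstract R (fun n x => Phi p ρ (u n x - v x)) _
      (fun n => (hRm n).aestronglyMeasurable) ?_ (fun n => (hPd n).1)
      (fun n x => Phi_nonneg _ _ _) (fun n => (hPd n).2) ?_).2
    · filter_upwards [hae, hd0] with x hx hx0
      have h1 := (hFc.tendsto (v x)).comp hx
      have h2 := (hFc.tendsto 0).comp hx0
      have h3 := (h1.sub h2).sub_const (Ffun f (v x))
      rw [Ffun_zero, sub_zero, sub_self] at h3
      exact h3
    · intro δ hδ
      obtain ⟨D', hD', hbl⟩ := F_BL hfc hp hq₁.le hq₁₂ hq2ρ hCpos hf1 hδ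
      refine ⟨fun x => D' * Phi p ρ (v x) + C₁ * Phi p ρ (v x),
        (hPv.1.const_mul D').add (hPv.1.const_mul C₁), fun n x => ?_⟩
      have h1 := hbl (u n x - v x) (v x)
      rw [sub_add_cancel] at h1
      have h2 := hF (v x)
      have h3 : 0 ≤ |Ffun f (v x)| ^ t := by positivity
      have h4 := abs_sub (Ffun f (u n x) - Ffun f (u n x - v x)) (Ffun f (v x))
      simp only [hR]
      linarith
  have hBR : ∀ n h, Good μ D h → BB μ (R n) h = BB μ (fun x => Ffun f (u n x)) h -
      BB μ (fun x => Ffun f (u n x - v x)) h - BB μ (fun x => Ffun f (v x)) h := by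
    intro n h hh
    have e1 := BB_sub_left ((gU n).meas.sub (gD n).meas) ((gU n).int.sub (gD n).int)
      gV.meas gV.int hh
    have e2 := BB_sub_left (gU n).meas (gU n).int (gD n).meas (gD n).int hh
    rw [← e2]
    exact e1
  have hlimR : ∀ h : ℕ → Euc N → ℝ, (∀ n, Good μ D (h n)) →
      Tendsto (fun n => BB μ (R n) (h n)) atTop (𝓝 0) := by
    intro h hh
    refine squeeze_zero_norm (fun n => BB_bound (hRm n) (hRi n) (hh n)) ?_
    simpa using hRlim.const_mul D
  have htot := ((((hlimR _ gU).add (hlimR _ gD)).add (hlimR _ (fun _ => gV))).add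
    (hcross.const_mul 2)).const_mul (1 / 2)
  simp only [mul_zero, add_zero] at htot
  refine htot.congr fun n => ?_
  rw [hBR n _ (gU n), hBR n _ (gD n), hBR n _ gV]
  have c1 := BB_comm (gU n).meas (gU n).int (gD n)
  have c2 := BB_comm (gU n).meas (gU n).int gV
  have c3 := BB_comm (gD n).meas (gD n).int gV
  have s1 : SigmaFun N μ f (u n) = 1 / 2 * BB μ (fun x => Ffun f (u n x))
    (fun x => Ffun f (u n x)) := rfl
  have s2 : SigmaFun N μ f (fun x => u n x - v x) = 1 / 2 * BB μ (fun x => Ffun f (u n x - v x))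
    (fun x => Ffun f (u n x - v x)) := rfl
  have s3 : SigmaFun N μ f v = 1 / 2 * BB μ (fun x => Ffun f (v x))
    (fun x => Ffun f (v x)) := rfl
  rw [s1, s2, s3, c1, c2, c3]
  ring
end
end

section
/- Let s ∈ (0,1), p ∈ (1,∞), N > sp, 0 < μ < sp, let V : ℝ^N → ℝ be continuous with inf_{ℝ^N} V > 0, let f satisfy (f1)–(f3), and fix ε > 0. Then: (i) there exist α > 0 and ρ > 0 such that J_ε(u) ≥ α for every u with ‖u‖_ε = ρ; (ii) there exists e with ‖e‖_ε > ρ and J_ε(e) < 0. -/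
open MeasureTheory Filter Topology
open scoped ENNReal

noncomputable section

lemma sob_point {N : ℕ} (hN0 : 0 < N) {s p r : ℝ} (hs : 0 < s) (hp : 1 < p) (hr0 : 0 < r)
    (hr : p + r * (s * p / N) = r) :
    ∃ K : ℝ, 0 < K ∧ ∀ v : Euc N → ℝ, (∀ x, 0 ≤ v x) → AEMeasurable v volume → ∀ M : ℝ, 0 < M →
      ∫⁻ y, ENNReal.ofReal (v y ^ r) ≤ ENNReal.ofReal M → ∀ x,
      ENNReal.ofReal (v x ^ r) ≤ ENNReal.ofReal (K * M ^ (s * p / N)) *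
        ∫⁻ y, ENNReal.ofReal (|v x - v y| ^ p / ‖x - y‖ ^ ((N : ℝ) + s * p)) := by
  have : Nonempty (Fin N) := ⟨⟨0, hN0⟩⟩
  have hNR : (0:ℝ) < N := by exact_mod_cast hN0
  obtain ⟨ω, hω⟩ : ∃ ω : ℝ, ω = (volume (Metric.ball (0 : Euc N) 1)).toReal := ⟨_, rfl⟩
  have hfin : volume (Metric.ball (0 : Euc N) 1) ≠ ⊤ := measure_ball_lt_top.ne
  have hωpos : 0 < ω := by
    rw [hω]; exact ENNReal.toReal_pos (Metric.measure_ball_pos _ _ one_pos).ne' hfin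
  refine ⟨2 ^ p * (2 / ω) * (2 ^ (r + 1) / ω) ^ (s * p / N), by positivity, ?_⟩
  intro v hv hvm M hM hint x
  rcases (hv x).eq_or_lt with h0 | ha
  · rw [← h0, Real.zero_rpow hr0.ne']; simp
  obtain ⟨a, hax⟩ : ∃ a, a = v x := ⟨_, rfl⟩
  rw [← hax] at ha ⊢
  obtain ⟨X, hX⟩ : ∃ X, X = (2 ^ (r+1) / ω) * M * a ^ (-r) := ⟨_, rfl⟩
  have hXpos : 0 < X := by rw [hX]; positivity
  obtain ⟨R, hR⟩ : ∃ R, R = X ^ (1 / (N:ℝ)) := ⟨_, rfl⟩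
  have hRpos : 0 < R := by rw [hR]; positivity
  have hRN : R ^ N = X := by
    rw [hR, ← Real.rpow_natCast, ← Real.rpow_mul hXpos.le]; simp [hNR.ne']
  have hRe : R ^ ((N:ℝ) + s * p) = X * X ^ (s * p / N) := by
    rw [hR, ← Real.rpow_mul hXpos.le, ← Real.rpow_one_add' hXpos.le (by positivity)]
    congr 1; field_simp
  obtain ⟨c, hc⟩ : ∃ c, c = (a/2)^p / R ^ ((N:ℝ) + s * p) := ⟨_, rfl⟩
  have hcpos : 0 < c := by rw [hc]; positivity
  have hball : volume (Metric.ball x R) = ENNReal.ofReal (ω * X) := by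
    rw [Measure.addHaar_ball _ _ hRpos.le, finrank_euclideanSpace_fin, hRN, mul_comm ω,
      ENNReal.ofReal_mul hXpos.le, hω, ENNReal.ofReal_toReal hfin]
  -- Chebyshev
  have hcheb : volume {y | a / 2 ≤ v y} ≤ ENNReal.ofReal (ω * X / 2) := by
    have h1 := mul_meas_ge_le_lintegral₀ (μ := volume)
      (f := fun y => ENNReal.ofReal (v y ^ r)) (by fun_prop) (ENNReal.ofReal ((a/2)^r))
    have hsub : {y | a / 2 ≤ v y} ⊆ {y | ENNReal.ofReal ((a/2)^r) ≤ ENNReal.ofReal (v y ^ r)} := by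
      intro y hy
      exact ENNReal.ofReal_le_ofReal (Real.rpow_le_rpow (by positivity) hy hr0.le)
    have h2 : ENNReal.ofReal ((a/2)^r) * volume {y | a / 2 ≤ v y} ≤ ENNReal.ofReal M :=
      (mul_le_mul_right (measure_mono hsub) _).trans (h1.trans hint)
    have h3 : ENNReal.ofReal M = ENNReal.ofReal ((a/2)^r) * ENNReal.ofReal (ω * X / 2) := by
      rw [← ENNReal.ofReal_mul (by positivity)]
      congr 1
      rw [hX, Real.div_rpow ha.le (by norm_num), Real.rpow_neg ha.le, Real.rpow_add (by norm_num),
        Real.rpow_one]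
      have := (Real.rpow_pos_of_pos ha r).ne'
      field_simp
    rw [h3] at h2
    exact (ENNReal.mul_le_mul_iff_right (by simpa using by positivity) ENNReal.ofReal_ne_top).1 h2
  have hS : ENNReal.ofReal (ω * X / 2) ≤ volume (Metric.ball x R \ {y | a / 2 ≤ v y}) := by
    refine le_trans ?_ (le_measure_sdiff)
    rw [hball]
    calc ENNReal.ofReal (ω * X / 2) = ENNReal.ofReal (ω * X) - ENNReal.ofReal (ω * X / 2) := by
          rw [← ENNReal.ofReal_sub _ (by positivity)]; congr 1; ring
      _ ≤ _ := tsub_le_tsub_left hcheb _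
  have hD := mul_meas_ge_le_lintegral₀ (μ := volume)
      (f := fun y => ENNReal.ofReal (|a - v y| ^ p / ‖x - y‖ ^ ((N : ℝ) + s * p)))
      (by fun_prop) (ENNReal.ofReal c)
  have hsub : Metric.ball x R \ {y | a / 2 ≤ v y} ⊆
      {y | ENNReal.ofReal c ≤ ENNReal.ofReal (|a - v y| ^ p / ‖x - y‖ ^ ((N : ℝ) + s * p))} := by
    rintro y ⟨hy, hy2⟩
    simp only [Set.mem_ofPred_eq, not_le] at hy2
    refine ENNReal.ofReal_le_ofReal ?_
    rw [hc]
    have hxy : x ≠ y := by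
      rintro rfl; linarith
    have hpos : 0 < ‖x - y‖ := norm_pos_iff.2 (sub_ne_zero.2 hxy)
    have hle : ‖x - y‖ ≤ R := by
      rw [← dist_eq_norm, dist_comm]; exact (Metric.mem_ball.1 hy).le
    have : a / 2 ≤ |a - v y| := le_trans (by linarith) (le_abs_self _)
    gcongr
  have hkey : ENNReal.ofReal c * ENNReal.ofReal (ω * X / 2) ≤
      ∫⁻ y, ENNReal.ofReal (|a - v y| ^ p / ‖x - y‖ ^ ((N : ℝ) + s * p)) :=
    (mul_le_mul_right (hS.trans (measure_mono hsub)) _).trans hD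
  refine le_trans (le_of_eq ?_) (mul_le_mul_right hkey _)
  rw [← ENNReal.ofReal_mul hcpos.le, ← ENNReal.ofReal_mul (by positivity)]
  congr 1
  rw [hc, hRe]
  have hXs : X ^ (s * p / N) = (2 ^ (r + 1) / ω) ^ (s * p / N) * M ^ (s * p / N) *
      (a ^ (r * (s * p / N)))⁻¹ := by
    rw [hX, Real.mul_rpow (by positivity) (by positivity), Real.mul_rpow (by positivity) hM.le,
      ← Real.rpow_mul ha.le, neg_mul, Real.rpow_neg ha.le]
  have har : a ^ r = a ^ p * a ^ (r * (s * p / N)) := by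
    rw [← Real.rpow_add ha, hr]
  rw [hXs, har, Real.div_rpow ha.le (by norm_num)]
  have h1 : (2 ^ (r + 1) / ω) ^ (s * p / N) ≠ 0 := by positivity
  have h2 : M ^ (s * p / N) ≠ 0 := by positivity
  have h3 : a ^ (r * (s * p / N)) ≠ 0 := by positivity
  have h4 : (2:ℝ) ^ p ≠ 0 := by positivity
  generalize (2 ^ (r + 1) / ω) ^ (s * p / N) = A at *
  generalize M ^ (s * p / N) = B at *
  generalize a ^ (r * (s * p / N)) = D at *
  field_simp

lemma gag_mono {N : ℕ} {s p : ℝ} (hp : 0 ≤ p) (u v : Euc N → ℝ)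
    (h : ∀ x y, |v x - v y| ≤ |u x - u y|) : gagliardoP N s p v ≤ gagliardoP N s p u := by
  unfold gagliardoP
  refine lintegral_mono fun x => lintegral_mono fun y => ENNReal.ofReal_le_ofReal ?_
  have := h x y
  gcongr

lemma sobolev_s7 {N : ℕ} (hN0 : 0 < N) {s p r : ℝ} (hs : 0 < s) (hp : 1 < p) (hpr : p ≤ r)
    (hr : p + r * (s * p / N) = r) :
    ∃ K : ℝ, 0 < K ∧ ∀ v : Euc N → ℝ, (∀ x, 0 ≤ v x) → AEMeasurable v volume →
      ∫⁻ y, ENNReal.ofReal (v y ^ p) < ⊤ → ∀ A : ℝ, 0 ≤ A →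
      gagliardoP N s p v ≤ ENNReal.ofReal A →
      ∫⁻ y, ENNReal.ofReal (v y ^ r) ≤ ENNReal.ofReal (K * A ^ (r / p)) := by
  have hr0 : 0 < r := by linarith
  have hp0 : 0 < p := by linarith
  obtain ⟨K, hK, H⟩ := sob_point hN0 hs hp hr0 hr
  refine ⟨K ^ (r / p), by positivity, ?_⟩
  intro v hv hvm hfin A hA hG
  -- truncated bound
  have key : ∀ k : ℕ, ∫⁻ y, ENNReal.ofReal (min (v y) k ^ r) ≤
      ENNReal.ofReal (K ^ (r / p) * A ^ (r / p)) := by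
    intro k
    have hk : (0:ℝ) ≤ k := k.cast_nonneg
    have hmn : ∀ y, 0 ≤ min (v y) (k:ℝ) := fun y => le_min (hv y) hk
    have hlt : ∫⁻ y, ENNReal.ofReal (min (v y) k ^ r) < ⊤ := by
      calc ∫⁻ y, ENNReal.ofReal (min (v y) k ^ r)
          ≤ ∫⁻ y, ENNReal.ofReal ((k:ℝ) ^ (r - p)) * ENNReal.ofReal (v y ^ p) := by
            refine lintegral_mono fun y => ?_
            rw [← ENNReal.ofReal_mul (by positivity)]
            refine ENNReal.ofReal_le_ofReal ?_
            have : min (v y) (k:ℝ) ^ r = min (v y) (k:ℝ) ^ (r - p) * min (v y) (k:ℝ) ^ p := by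
              rw [← Real.rpow_add_of_nonneg (hmn y) (by linarith) hp0.le]; congr 1; ring
            rw [this]
            have h1 := min_le_left (v y) (k:ℝ)
            have h2 := min_le_right (v y) (k:ℝ)
            have h3 := hmn y
            have h4 := hv y
            apply mul_le_mul
            · exact Real.rpow_le_rpow h3 h2 (by linarith)
            · exact Real.rpow_le_rpow h3 h1 hp0.le
            · positivity
            · positivity
        _ = ENNReal.ofReal ((k:ℝ) ^ (r - p)) * ∫⁻ y, ENNReal.ofReal (v y ^ p) :=
            lintegral_const_mul' _ _ ENNReal.ofReal_ne_top
        _ < ⊤ := ENNReal.mul_lt_top ENNReal.ofReal_lt_top hfin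
    obtain ⟨M, hM⟩ : ∃ M, M = (∫⁻ y, ENNReal.ofReal (min (v y) k ^ r)).toReal := ⟨_, rfl⟩
    have hMe : ∫⁻ y, ENNReal.ofReal (min (v y) k ^ r) = ENNReal.ofReal M := by
      rw [hM, ENNReal.ofReal_toReal hlt.ne]
    rw [hMe]
    have hM0 : 0 ≤ M := by rw [hM]; exact ENNReal.toReal_nonneg
    rcases hM0.eq_or_lt with h0 | hMpos
    · rw [← h0]; simp
    have h1 := H (fun y => min (v y) k) hmn (by fun_prop) M hMpos hMe.le
    have h2 : ENNReal.ofReal M ≤ ENNReal.ofReal (K * M ^ (s * p / N)) * ENNReal.ofReal A := by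
      rw [← hMe]
      refine (lintegral_mono h1).trans ?_
      rw [lintegral_const_mul' _ _ ENNReal.ofReal_ne_top]
      refine mul_le_mul_right (le_trans (gag_mono (s := s) hp0.le v (fun y => min (v y) k) ?_) hG) _
      intro x y
      simpa using abs_min_sub_min_le_max (v x) k (v y) k
    rw [← ENNReal.ofReal_mul (by positivity), ENNReal.ofReal_le_ofReal_iff (by positivity)] at h2
    have h3 : M ^ (p / r) ≤ K * A := by
      have e : p / r = 1 - s * p / N := by
        field_simp; field_simp at hr; linarith
      have hpos : 0 < M ^ (s * p / N) := by positivity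
      rw [e, Real.rpow_sub hMpos, Real.rpow_one, div_le_iff₀ hpos]
      linarith
    refine ENNReal.ofReal_le_ofReal ?_
    rw [← Real.mul_rpow hK.le hA]
    calc M = (M ^ (p / r)) ^ (r / p) := by
          rw [← Real.rpow_mul hM0]; field_simp; simp
      _ ≤ _ := Real.rpow_le_rpow (by positivity) h3 (by positivity)
  refine le_of_tendsto' (lintegral_tendsto_of_tendsto_of_monotone
    (f := fun k : ℕ => fun y => ENNReal.ofReal (min (v y) k ^ r)) ?_ ?_ ?_) key
  · intro k; fun_prop
  · refine ae_of_all _ fun y => ?_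
    intro k l hkl
    refine ENNReal.ofReal_le_ofReal (Real.rpow_le_rpow (le_min (hv y) k.cast_nonneg) ?_ hr0.le)
    exact min_le_min_left _ (by exact_mod_cast hkl)
  · refine ae_of_all _ fun y => ?_
    refine tendsto_const_nhds.congr' ?_
    obtain ⟨k, hk⟩ := exists_nat_ge (v y)
    filter_upwards [eventually_ge_atTop k] with l hl
    rw [min_eq_left (hk.trans (by exact_mod_cast hl))]

lemma pow_interp {p q r t : ℝ} (hp : 0 < p) (hpq : p ≤ q) (hqr : q ≤ r) (ht : 0 ≤ t) :
    t ^ q ≤ t ^ p + t ^ r := by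
  have h1 : 0 ≤ t ^ p := by positivity
  have h2 : 0 ≤ t ^ r := by positivity
  rcases ht.eq_or_lt with h | h
  · subst h
    rw [Real.zero_rpow (x := q) (by linarith)]; linarith
  rcases le_total t 1 with h' | h'
  · have := Real.rpow_le_rpow_of_exponent_ge h h' hpq; linarith
  · have := Real.rpow_le_rpow_of_exponent_le h' hqr; linarith

lemma interp {N : ℕ} {p q r A B l : ℝ} (hp : 0 < p) (hpq : p ≤ q) (hqr : q ≤ r) (hl : 0 < l)
    (hA : 0 ≤ A) (hB : 0 ≤ B) (v : Euc N → ℝ) (hv : ∀ x, 0 ≤ v x) (hvm : AEMeasurable v volume)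
    (h1 : ∫⁻ y, ENNReal.ofReal (v y ^ p) ≤ ENNReal.ofReal (A * l ^ p))
    (h2 : ∫⁻ y, ENNReal.ofReal (v y ^ r) ≤ ENNReal.ofReal (B * l ^ r)) :
    ∫⁻ y, ENNReal.ofReal (v y ^ q) ≤ ENNReal.ofReal ((A + B) * l ^ q) := by
  have hb : ∀ y, ENNReal.ofReal (v y ^ q) ≤
      ENNReal.ofReal (l ^ (q - p)) * ENNReal.ofReal (v y ^ p) +
      ENNReal.ofReal (l ^ (q - r)) * ENNReal.ofReal (v y ^ r) := by
    intro y
    have := hv y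
    rw [← ENNReal.ofReal_mul (by positivity), ← ENNReal.ofReal_mul (by positivity),
      ← ENNReal.ofReal_add (by positivity) (by positivity)]
    refine ENNReal.ofReal_le_ofReal ?_
    have h := pow_interp hp hpq hqr (t := v y / l) (by positivity)
    rw [Real.div_rpow this hl.le, Real.div_rpow this hl.le, Real.div_rpow this hl.le,
      div_le_iff₀ (by positivity)] at h
    refine h.trans (le_of_eq ?_)
    rw [Real.rpow_sub hl, Real.rpow_sub hl]
    ring
  refine (lintegral_mono hb).trans ?_
  rw [lintegral_add_left' (by fun_prop), lintegral_const_mul' _ _ ENNReal.ofReal_ne_top,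
    lintegral_const_mul' _ _ ENNReal.ofReal_ne_top]
  refine (add_le_add (mul_le_mul_right h1 _) (mul_le_mul_right h2 _)).trans (le_of_eq ?_)
  rw [← ENNReal.ofReal_mul (by positivity), ← ENNReal.ofReal_mul (by positivity),
      ← ENNReal.ofReal_add (by positivity) (by positivity)]
  congr 1
  rw [Real.rpow_sub hl, Real.rpow_sub hl]
  field_simp

/-- The truncated singular kernel. -/
def nearK (N : ℕ) (m : ℝ) (z : Euc N) : ℝ := if ‖z‖ < 1 then ‖z‖ ^ (-m) else 0

lemma nearK_nonneg (N : ℕ) (m : ℝ) (z : Euc N) : 0 ≤ nearK N m z := by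
  unfold nearK; split_ifs <;> positivity

lemma nearK_meas (N : ℕ) (m : ℝ) : Measurable (nearK N m) := by
  unfold nearK
  exact Measurable.ite (measurableSet_lt (by fun_prop) (by fun_prop)) (by fun_prop) (by fun_prop)

lemma nearK_fin {N : ℕ} (hN0 : 0 < N) {m : ℝ} (hm : m < N) :
    ∫⁻ z, ENNReal.ofReal (nearK N m z) < ⊤ := by
  have h := integrableOn_ball_of_norm_le_rpow (μ := (volume : Measure (Euc N)))
    (f := fun z : Euc N => ‖z‖ ^ (-m)) (C := 1) (α := m) (r := 1)
    (by rw [finrank_euclideanSpace_fin]; exact hN0) (by rw [finrank_euclideanSpace_fin]; exact hm)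
    (ae_of_all _ fun z => by
      rw [one_mul, Real.norm_of_nonneg (by positivity)])
    (by apply Measurable.aestronglyMeasurable; fun_prop)
  have h2 := (h.integrable_indicator measurableSet_ball)
  have h3 : (Metric.ball (0 : Euc N) 1).indicator (fun z : Euc N => ‖z‖ ^ (-m)) = nearK N m := by
    funext z
    simp [Set.indicator, nearK]
  rw [h3] at h2
  have h4 := h2.2
  rwa [hasFiniteIntegral_iff_ofReal (ae_of_all _ (nearK_nonneg N m))] at h4

lemma farK_fin {N : ℕ} (hN0 : 0 < N) {s p : ℝ} (hs : 0 < s) (hs1 : s < 1) (hp : 1 < p) :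
    ∫⁻ z : Euc N, ENNReal.ofReal (min 1 ‖z‖ ^ p / ‖z‖ ^ ((N:ℝ) + s * p)) < ⊤ := by
  have hsp : 0 < s * p := by positivity
  have hp0 : 0 < p := by linarith
  have hNR : (0:ℝ) < N := by exact_mod_cast hN0
  have h1 := nearK_fin hN0 (m := (N:ℝ) + s * p - p) (by nlinarith)
  have h2 := finite_integral_one_add_norm (E := Euc N) (μ := volume) (r := (N:ℝ) + s * p)
    (by rw [finrank_euclideanSpace_fin]; linarith)
  have hb : ∀ z : Euc N, ENNReal.ofReal (min 1 ‖z‖ ^ p / ‖z‖ ^ ((N:ℝ) + s * p)) ≤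
      ENNReal.ofReal (nearK N ((N:ℝ) + s * p - p) z) +
      ENNReal.ofReal (2 ^ ((N:ℝ) + s * p)) * ENNReal.ofReal ((1 + ‖z‖) ^ (-((N:ℝ) + s * p))) := by
    intro z
    rw [← ENNReal.ofReal_mul (by positivity),
      ← ENNReal.ofReal_add (nearK_nonneg _ _ _) (by positivity)]
    refine ENNReal.ofReal_le_ofReal ?_
    unfold nearK
    rcases lt_or_ge ‖z‖ 1 with h | h
    · rw [if_pos h, min_eq_right h.le]
      have : 0 ≤ (2:ℝ) ^ ((N:ℝ) + s * p) * (1 + ‖z‖) ^ (-((N:ℝ) + s * p)) := by positivity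
      rcases (norm_nonneg z).eq_or_lt with h0 | h0
      · rw [← h0, Real.zero_rpow hp0.ne', zero_div]; rw [← h0] at this; positivity
      · rw [neg_sub, Real.rpow_sub h0]; linarith
    · rw [if_neg (not_lt.2 h), min_eq_left h, Real.one_rpow, zero_add,
        Real.rpow_neg (by positivity), ← div_eq_mul_inv, ← Real.div_rpow (by norm_num) (by positivity),
        ← Real.one_rpow ((N:ℝ) + s * p), ← Real.div_rpow (by norm_num) (by positivity), Real.one_rpow]
      refine Real.rpow_le_rpow (by positivity) ?_ (by positivity)
      rw [div_le_div_iff₀ (by linarith) (by linarith)]; linarith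
  refine (lintegral_mono hb).trans_lt ?_
  rw [lintegral_add_left (by have := nearK_meas N ((N:ℝ) + s * p - p); fun_prop),
    lintegral_const_mul' _ _ ENNReal.ofReal_ne_top]
  exact ENNReal.add_lt_top.2 ⟨h1, ENNReal.mul_lt_top ENNReal.ofReal_lt_top h2⟩

lemma conv_one {N : ℕ} {p q r t μ τ : ℝ} (hp : 0 < p) (hpq : p ≤ q) (ht : 1 < t) (hqt : q * t ≤ r)
    (hμ : 0 < μ) (hτ : 0 ≤ τ) (z : Euc N) :
    τ ^ q / ‖z‖ ^ μ ≤ τ ^ p + τ ^ r + nearK N (μ * (t / (t - 1))) z := by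
  have hq : 0 < q := by linarith
  have hqr : q ≤ r := by nlinarith
  have hpqt : p ≤ q * t := by nlinarith
  unfold nearK
  rcases lt_or_ge ‖z‖ 1 with h | h
  · rw [if_pos h]
    have hc : Real.HolderConjugate t (t / (t - 1)) := Real.HolderConjugate.conjExponent ht
    have hy := Real.young_inequality_of_nonneg (a := τ ^ q) (b := ‖z‖ ^ (-μ)) (by positivity)
      (by positivity) hc
    rw [← Real.rpow_mul hτ, ← Real.rpow_mul (norm_nonneg z), neg_mul] at hy
    rw [div_eq_mul_inv, ← Real.rpow_neg (norm_nonneg z)]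
    have h1 : τ ^ (q * t) / t ≤ τ ^ (q * t) := div_le_self (by positivity) ht.le
    have h2 : ‖z‖ ^ (-(μ * (t / (t - 1)))) / (t / (t - 1)) ≤ ‖z‖ ^ (-(μ * (t / (t - 1)))) :=
      div_le_self (by positivity) hc.symm.lt.le
    have h3 := pow_interp hp hpqt hqt hτ
    linarith
  · rw [if_neg (not_lt.2 h)]
    have h1 : 1 ≤ ‖z‖ ^ μ := Real.one_le_rpow h hμ.le
    have h2 : τ ^ q / ‖z‖ ^ μ ≤ τ ^ q := div_le_self (by positivity) h1
    have h3 := pow_interp hp hpq hqr hτ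
    linarith

lemma conv_bound {N : ℕ} (hN0 : 0 < N) {p q₁ q₂ r t μ C : ℝ} (hp : 0 < p) (hq₁ : p ≤ q₁)
    (hq₁₂ : q₁ ≤ q₂) (ht : 1 < t) (hqt : q₂ * t ≤ r) (hμ : 0 < μ) (hC : 0 ≤ C)
    (hm : μ * (t / (t - 1)) < N) :
    ∃ κ : ℝ, 0 ≤ κ ∧ ∀ (v w : Euc N → ℝ) (A B : ℝ), 0 ≤ A → 0 ≤ B → (∀ x, 0 ≤ v x) →
      AEMeasurable v volume →
      (∀ x, w x ≤ C * (v x ^ q₁ + v x ^ q₂)) →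
      ∫⁻ y, ENNReal.ofReal (v y ^ p) ≤ ENNReal.ofReal A →
      ∫⁻ y, ENNReal.ofReal (v y ^ r) ≤ ENNReal.ofReal B →
      ∀ x, ∫⁻ y, ENNReal.ofReal (w y / ‖x - y‖ ^ μ) ≤ ENNReal.ofReal (2 * C * (A + B + κ)) := by
  have hfin := nearK_fin hN0 hm
  refine ⟨(∫⁻ z, ENNReal.ofReal (nearK N (μ * (t / (t - 1))) z)).toReal, ENNReal.toReal_nonneg, ?_⟩
  intro v w A B hA hB hv hvm hw h1 h2 x
  have hb : ∀ y, ENNReal.ofReal (w y / ‖x - y‖ ^ μ) ≤ ENNReal.ofReal (2 * C) *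
      (ENNReal.ofReal (v y ^ p) + ENNReal.ofReal (v y ^ r) +
        ENNReal.ofReal (nearK N (μ * (t / (t - 1))) (x - y))) := by
    intro y
    have hn := nearK_nonneg N (μ * (t / (t - 1))) (x - y)
    have hvy := hv y
    rw [← ENNReal.ofReal_add (by positivity) (by positivity),
      ← ENNReal.ofReal_add (by positivity) hn, ← ENNReal.ofReal_mul (by positivity)]
    refine ENNReal.ofReal_le_ofReal ?_
    have e1 := conv_one hp hq₁ ht (le_trans (by nlinarith) hqt) hμ hvy (x - y)
    have e2 := conv_one hp (hq₁.trans hq₁₂) ht hqt hμ hvy (x - y)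
    calc w y / ‖x - y‖ ^ μ ≤ C * (v y ^ q₁ + v y ^ q₂) / ‖x - y‖ ^ μ := by
          have := hw y; gcongr
      _ = C * (v y ^ q₁ / ‖x - y‖ ^ μ + v y ^ q₂ / ‖x - y‖ ^ μ) := by ring
      _ ≤ C * (2 * (v y ^ p + v y ^ r + nearK N (μ * (t / (t - 1))) (x - y))) := by
          apply mul_le_mul_of_nonneg_left _ hC; linarith
      _ = _ := by ring
  refine (lintegral_mono hb).trans ?_
  have hmeas := nearK_meas N (μ * (t / (t - 1)))
  rw [lintegral_const_mul' _ _ ENNReal.ofReal_ne_top, lintegral_add_left' (by fun_prop),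
    lintegral_add_left' (by fun_prop),
    lintegral_sub_left_eq_self (fun z => ENNReal.ofReal (nearK N (μ * (t / (t - 1))) z)) x,
    ENNReal.ofReal_mul (show (0:ℝ) ≤ 2 * C by positivity),
    ENNReal.ofReal_add (show (0:ℝ) ≤ A + B by positivity) ENNReal.toReal_nonneg,
    ENNReal.ofReal_add hA hB, ENNReal.ofReal_toReal hfin.ne]
  gcongr

lemma F_hasDeriv {f : ℝ → ℝ} (hfc : Continuous f) (t : ℝ) : HasDerivAt (Ffun f) (f t) t := by
  unfold Ffun
  exact intervalIntegral.integral_hasDerivAt_right (hfc.intervalIntegrable _ _)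
    (hfc.stronglyMeasurableAtFilter _ _) hfc.continuousAt

lemma F_cont {f : ℝ → ℝ} (hfc : Continuous f) : Continuous (Ffun f) :=
  continuous_iff_continuousAt.2 fun t => (F_hasDeriv hfc t).continuousAt

lemma F_nonpos {f : ℝ → ℝ} (hf0 : ∀ t ≤ (0 : ℝ), f t = 0) {t : ℝ} (ht : t ≤ 0) : Ffun f t = 0 := by
  unfold Ffun
  rw [intervalIntegral.integral_symm, intervalIntegral.integral_congr (g := fun _ => 0)]
  · simp
  · intro x hx
    rw [Set.uIcc_of_le ht] at hx
    exact hf0 x hx.2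

lemma F_max {f : ℝ → ℝ} (hf0 : ∀ t ≤ (0 : ℝ), f t = 0) (t : ℝ) :
    Ffun f t = Ffun f (max t 0) := by
  rcases le_total t 0 with h | h
  · rw [max_eq_right h, F_nonpos hf0 h, F_nonpos hf0 le_rfl]
  · rw [max_eq_left h]

lemma F_bound {f : ℝ → ℝ} {q₁ q₂ C : ℝ} (hC : 0 < C) (hq₁ : 1 < q₁) (hq₂ : 1 < q₂)
    (hf1 : ∀ t : ℝ, |f t| ≤ C * (|t| ^ (q₁ - 1) + |t| ^ (q₂ - 1))) {t : ℝ} (ht : 0 ≤ t) :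
    Ffun f t ≤ C * (t ^ q₁ + t ^ q₂) := by
  rcases ht.eq_or_lt with h | h
  · subst h; simp [Ffun, Real.zero_rpow (show q₁ ≠ 0 by linarith),
      Real.zero_rpow (show q₂ ≠ 0 by linarith)]
  have := intervalIntegral.norm_integral_le_of_norm_le_const (f := f) (a := 0) (b := t)
    (C := C * (t ^ (q₁ - 1) + t ^ (q₂ - 1))) (by
      intro x hx
      rw [Set.uIoc_of_le ht] at hx
      refine (hf1 x).trans ?_
      rw [abs_of_pos hx.1]
      have h1 := Real.rpow_le_rpow hx.1.le hx.2 (show 0 ≤ q₁ - 1 by linarith)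
      have h2 := Real.rpow_le_rpow hx.1.le hx.2 (show 0 ≤ q₂ - 1 by linarith)
      gcongr)
  refine (le_abs_self _).trans (this.trans (le_of_eq ?_))
  rw [sub_zero, abs_of_pos h, Real.rpow_sub h, Real.rpow_sub h, Real.rpow_one]
  field_simp

lemma F_growth {f : ℝ → ℝ} (hfc : Continuous f) {θ : ℝ}
    (hf2 : ∀ t : ℝ, 0 < t → 0 < θ * Ffun f t ∧ θ * Ffun f t ≤ 2 * f t * t)
    {T τ : ℝ} (hT : 1 ≤ T) (hτ : 0 < τ) : T ^ (θ / 2) * Ffun f τ ≤ Ffun f (T * τ) := by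
  have hmono : MonotoneOn (fun t : ℝ => Ffun f t * t ^ (-(θ / 2))) (Set.Ioi 0) := by
    have hd : ∀ x : ℝ, 0 < x → HasDerivAt (fun t : ℝ => Ffun f t * t ^ (-(θ / 2)))
        (f x * x ^ (-(θ / 2)) + Ffun f x * (-(θ / 2) * x ^ (-(θ / 2) - 1))) x := by
      intro x hx
      exact (F_hasDeriv hfc x).mul (Real.hasDerivAt_rpow_const (Or.inl hx.ne'))
    refine monotoneOn_of_deriv_nonneg (convex_Ioi 0) ?_ ?_ ?_
    · exact fun x hx => (hd x hx).continuousAt.continuousWithinAt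
    · rw [interior_Ioi]
      exact fun x hx => (hd x hx).differentiableAt.differentiableWithinAt
    · rw [interior_Ioi]
      intro x hx
      have hx' : 0 < x := hx
      rw [(hd x hx).deriv, Real.rpow_sub hx', Real.rpow_one]
      have h := (hf2 x hx).2
      have e : f x * x ^ (-(θ / 2)) + Ffun f x * (-(θ / 2) * (x ^ (-(θ / 2)) / x)) =
        (x ^ (-(θ / 2)) / (2 * x)) * (2 * f x * x - θ * Ffun f x) := by
        field_simp; ring
      rw [e]
      have : 0 ≤ 2 * f x * x - θ * Ffun f x := by linarith
      positivity
  have hTτ : 0 < T * τ := by positivity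
  have h := hmono (Set.mem_Ioi.2 hτ) (Set.mem_Ioi.2 hTτ) (by nlinarith)
  simp only at h
  rw [Real.mul_rpow (by linarith) hτ.le, ← mul_assoc] at h
  have h2 := le_of_mul_le_mul_right h (by positivity)
  rw [Real.rpow_neg (by linarith), ← div_eq_mul_inv, le_div_iff₀ (by positivity)] at h2
  linarith

lemma F_strict {f : ℝ → ℝ} (hfc : Continuous f) {θ : ℝ}
    (hf2 : ∀ t : ℝ, 0 < t → 0 < θ * Ffun f t ∧ θ * Ffun f t ≤ 2 * f t * t) :
    StrictMonoOn (Ffun f) (Set.Ici 0) := by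
  refine strictMonoOn_of_deriv_pos (convex_Ici 0) (F_cont hfc).continuousOn ?_
  rw [interior_Ici]
  intro x hx
  rw [(F_hasDeriv hfc x).deriv]
  have hx' : 0 < x := hx
  have h := hf2 x hx
  have : 0 < f x * x := by linarith [h.1.trans_le h.2]
  exact pos_of_mul_pos_left this hx'.le

lemma F_aemeas {N : ℕ} {f : ℝ → ℝ} (hfc : Continuous f) (hf0 : ∀ t ≤ (0 : ℝ), f t = 0) {θ : ℝ}
    (hf2 : ∀ t : ℝ, 0 < t → 0 < θ * Ffun f t ∧ θ * Ffun f t ≤ 2 * f t * t)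
    (u : Euc N → ℝ) (h : AEMeasurable (fun x => Ffun f (u x)) volume) :
    AEMeasurable (fun x => max (u x) 0) volume := by
  have hst := F_strict hfc hf2
  have hcont : Continuous (fun t : ℝ => Ffun f t + min t 0) :=
    (F_cont hfc).add (continuous_id.min continuous_const)
  have hs : StrictMono (fun t : ℝ => Ffun f t + min t 0) := by
    intro a b hab
    simp only
    rcases le_or_gt 0 a with ha | ha
    · have := hst (Set.mem_Ici.2 ha) (Set.mem_Ici.2 (ha.trans hab.le)) hab
      rw [min_eq_right ha, min_eq_right (ha.trans hab.le)]; linarith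
    · rw [F_nonpos hf0 ha.le, min_eq_left ha.le]
      rcases le_total b 0 with hb | hb
      · rw [F_nonpos hf0 hb, min_eq_left hb]; linarith
      · have := hst.monotoneOn (Set.mem_Ici.2 le_rfl) (Set.mem_Ici.2 hb) hb
        rw [F_nonpos hf0 le_rfl] at this
        rw [min_eq_right hb]; linarith
  have hemb := hcont.measurableEmbedding hs.injective
  rw [← hemb.aemeasurable_comp_iff]
  convert h using 1
  funext x
  simp only [Function.comp]
  rw [min_eq_right (le_max_right _ _), add_zero, ← F_max hf0]

lemma int_le {α : Type*} [MeasurableSpace α] {ν : Measure α} {g : α → ℝ} (hg : ∀ x, 0 ≤ g x) {K : ℝ}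
    (hK : 0 ≤ K) (h : ∫⁻ x, ENNReal.ofReal (g x) ∂ν ≤ ENNReal.ofReal K) : ∫ x, g x ∂ν ≤ K := by
  by_cases hm : AEStronglyMeasurable g ν
  · rw [integral_eq_lintegral_of_nonneg_ae (ae_of_all _ hg) hm]
    exact ENNReal.toReal_le_of_le_ofReal hK h
  · rw [integral_non_aestronglyMeasurable hm]; exact hK

lemma inner_lint {N : ℕ} {μ K : ℝ} (w : Euc N → ℝ) (hw : ∀ x, 0 ≤ w x)
    (h1 : ∀ x, ∫⁻ y, ENNReal.ofReal (w y / ‖x - y‖ ^ μ) ≤ ENNReal.ofReal K) (x : Euc N) :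
    ∫⁻ y, ENNReal.ofReal (w x * w y / ‖x - y‖ ^ μ) ≤ ENNReal.ofReal (w x * K) := by
  have : ∀ y, ENNReal.ofReal (w x * w y / ‖x - y‖ ^ μ) =
      ENNReal.ofReal (w x) * ENNReal.ofReal (w y / ‖x - y‖ ^ μ) := by
    intro y; rw [← ENNReal.ofReal_mul (hw x), mul_div_assoc]
  simp_rw [this]
  rw [lintegral_const_mul' _ _ ENNReal.ofReal_ne_top, ENNReal.ofReal_mul (hw x)]
  exact mul_le_mul_right (h1 x) _

lemma outer_lint {N : ℕ} {μ K L : ℝ} (w : Euc N → ℝ) (hw : ∀ x, 0 ≤ w x) (hK : 0 ≤ K)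
    (h1 : ∀ x, ∫⁻ y, ENNReal.ofReal (w y / ‖x - y‖ ^ μ) ≤ ENNReal.ofReal K)
    (h2 : ∫⁻ y, ENNReal.ofReal (w y) ≤ ENNReal.ofReal L) :
    ∫⁻ x, ENNReal.ofReal (∫ y, w x * w y / ‖x - y‖ ^ μ) ≤ ENNReal.ofReal (K * L) := by
  have hin : ∀ x, ∫ y, w x * w y / ‖x - y‖ ^ μ ≤ K * w x := by
    intro x
    have := hw x
    refine int_le (fun y => ?_) (by positivity) ?_
    · have := hw y; positivity
    · rw [mul_comm]; exact inner_lint w hw h1 x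
  refine (lintegral_mono fun x => ENNReal.ofReal_le_ofReal (hin x)).trans ?_
  simp_rw [ENNReal.ofReal_mul hK]
  rw [lintegral_const_mul' _ _ ENNReal.ofReal_ne_top]
  exact mul_le_mul_right h2 _

lemma sigma_le {N : ℕ} {μ K L : ℝ} (w : Euc N → ℝ) (hw : ∀ x, 0 ≤ w x) (hK : 0 ≤ K) (hL : 0 ≤ L)
    (h1 : ∀ x, ∫⁻ y, ENNReal.ofReal (w y / ‖x - y‖ ^ μ) ≤ ENNReal.ofReal K)
    (h2 : ∫⁻ y, ENNReal.ofReal (w y) ≤ ENNReal.ofReal L) :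
    ∫ x, ∫ y, w x * w y / ‖x - y‖ ^ μ ≤ K * L := by
  refine int_le (fun x => integral_nonneg fun y => ?_) (by positivity) (outer_lint w hw hK h1 h2)
  have := hw y
  have := hw x
  simp only [Pi.zero_apply]
  positivity

lemma sigma_ge {N : ℕ} (hN0 : 0 < N) {μ K L c : ℝ} (hμ : 0 < μ) (w : Euc N → ℝ) (hw : ∀ x, 0 ≤ w x)
    (hwm : Measurable w) (hK : 0 ≤ K)
    (h1 : ∀ x, ∫⁻ y, ENNReal.ofReal (w y / ‖x - y‖ ^ μ) ≤ ENNReal.ofReal K)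
    (h2 : ∫⁻ y, ENNReal.ofReal (w y) ≤ ENNReal.ofReal L) (hc : 0 ≤ c)
    (hwc : ∀ x ∈ Metric.ball (0 : Euc N) (1/2), c ≤ w x) :
    c ^ 2 * (volume.real (Metric.ball (0 : Euc N) (1/2))) ^ 2 ≤
      ∫ x, ∫ y, w x * w y / ‖x - y‖ ^ μ := by
  have : Nonempty (Fin N) := ⟨⟨0, hN0⟩⟩
  obtain ⟨B, hB⟩ : ∃ B, B = Metric.ball (0 : Euc N) (1/2) := ⟨_, rfl⟩
  have hBm : MeasurableSet B := hB ▸ measurableSet_ball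
  have hBf : volume B ≠ ⊤ := hB ▸ measure_ball_lt_top.ne
  rw [← hB] at hwc ⊢
  have hg : ∀ x y, 0 ≤ w x * w y / ‖x - y‖ ^ μ := by
    intro x y; have := hw x; have := hw y; positivity
  have hmeas2 : Measurable (fun z : Euc N × Euc N => w z.1 * w z.2 / ‖z.1 - z.2‖ ^ μ) := by
    fun_prop
  have hiI : ∀ x, Integrable (fun y => w x * w y / ‖x - y‖ ^ μ) volume := by
    intro x
    refine ⟨Measurable.aestronglyMeasurable (by fun_prop), ?_⟩
    rw [hasFiniteIntegral_iff_ofReal (ae_of_all _ (hg x))]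
    exact (inner_lint w hw h1 x).trans_lt ENNReal.ofReal_lt_top
  have hoI : Integrable (fun x => ∫ y, w x * w y / ‖x - y‖ ^ μ) volume := by
    refine ⟨?_, ?_⟩
    · exact (hmeas2.stronglyMeasurable.integral_prod_right).aestronglyMeasurable
    rw [hasFiniteIntegral_iff_ofReal (ae_of_all _ fun x => integral_nonneg (hg x))]
    exact (outer_lint w hw hK h1 h2).trans_lt ENNReal.ofReal_lt_top
  have hae : ∀ x ∈ B, ∀ y ∈ B, x ≠ y → c ^ 2 ≤ w x * w y / ‖x - y‖ ^ μ := by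
    intro x hx y hy hxy
    have hpos : 0 < ‖x - y‖ := norm_pos_iff.2 (sub_ne_zero.2 hxy)
    have hle : ‖x - y‖ ≤ 1 := by
      rw [hB, mem_ball_zero_iff] at hx hy
      linarith [norm_sub_le x y]
    have h3 : ‖x - y‖ ^ μ ≤ 1 := Real.rpow_le_one hpos.le hle hμ.le
    have h4 : c ^ 2 ≤ w x * w y := by
      rw [sq]; exact mul_le_mul (hwc x hx) (hwc y hy) hc (hw x)
    refine h4.trans ?_
    rw [le_div_iff₀ (by positivity)]
    exact mul_le_of_le_one_right (by positivity [hw x, hw y]) h3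
  have hin : ∀ x ∈ B, c ^ 2 * volume.real B ≤ ∫ y, w x * w y / ‖x - y‖ ^ μ := by
    intro x hx
    calc c ^ 2 * volume.real B = ∫ y in B, c ^ 2 := by
          rw [setIntegral_const, smul_eq_mul, mul_comm]
      _ ≤ ∫ y in B, w x * w y / ‖x - y‖ ^ μ := by
          refine setIntegral_mono_on_ae (integrableOn_const hBf) (hiI x).integrableOn hBm ?_
          have hx0 : ∀ᵐ y : Euc N, y ≠ x := by
            rw [ae_iff]; simp
          filter_upwards [hx0] with y hy hyB
          exact hae x hx y hyB hy.symm
      _ ≤ _ := setIntegral_le_integral (hiI x) (ae_of_all _ (hg x))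
  calc c ^ 2 * (volume.real B) ^ 2 = ∫ x in B, c ^ 2 * volume.real B := by
          rw [setIntegral_const, smul_eq_mul]; ring
      _ ≤ ∫ x in B, ∫ y, w x * w y / ‖x - y‖ ^ μ :=
          setIntegral_mono_on (integrableOn_const hBf) hoI.integrableOn hBm hin
      _ ≤ _ := setIntegral_le_integral hoI (ae_of_all _ fun x => integral_nonneg (hg x))

lemma sigma_zero {N : ℕ} (hN0 : 0 < N) {μ : ℝ} (w : Euc N → ℝ)
    (hwm : ¬ AEMeasurable w volume) :
    ∫ x, ∫ y, w x * w y / ‖x - y‖ ^ μ = 0 := by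
  have : Nonempty (Fin N) := ⟨⟨0, hN0⟩⟩
  have : ∀ x, ∫ y, w x * w y / ‖x - y‖ ^ μ = 0 := by
    intro x
    by_cases hx : w x = 0
    · simp [hx]
    refine integral_non_aestronglyMeasurable fun h => hwm ?_
    have h1 : AEMeasurable (fun y => w x * w y / ‖x - y‖ ^ μ * (‖x - y‖ ^ μ / w x)) volume :=
      h.aemeasurable.mul (by fun_prop)
    refine h1.congr ?_
    have hx0 : ∀ᵐ y : Euc N, y ≠ x := by
      rw [ae_iff]; simp
    filter_upwards [hx0] with y hy
    have hpos : 0 < ‖x - y‖ := norm_pos_iff.2 (sub_ne_zero.2 hy.symm)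
    have : 0 < ‖x - y‖ ^ μ := by positivity
    field_simp
  simp [this]

/-- The Lipschitz bump. -/
def bump (N : ℕ) (x : Euc N) : ℝ := max 0 (1 - ‖x‖)

lemma bump_nonneg {N : ℕ} (x : Euc N) : 0 ≤ bump N x := le_max_left _ _

lemma bump_le_one {N : ℕ} (x : Euc N) : bump N x ≤ 1 :=
  max_le zero_le_one (by linarith [norm_nonneg x])

lemma bump_cont (N : ℕ) : Continuous (bump N) := by unfold bump; fun_prop

lemma bump_zero {N : ℕ} {x : Euc N} (hx : x ∉ Metric.ball (0 : Euc N) 1) : bump N x = 0 := by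
  rw [mem_ball_zero_iff, not_lt] at hx
  exact max_eq_left (by linarith)

lemma bump_lip {N : ℕ} (x y : Euc N) : |bump N x - bump N y| ≤ min 1 ‖x - y‖ := by
  refine le_min ?_ ?_
  · rw [abs_le]
    constructor <;> linarith [bump_nonneg x, bump_nonneg y, bump_le_one x, bump_le_one y]
  · have h1 := abs_max_sub_max_le_max 0 (1 - ‖x‖) 0 (1 - ‖y‖)
    have h2 : |1 - ‖x‖ - (1 - ‖y‖)| ≤ ‖x - y‖ := by
      rw [show 1 - ‖x‖ - (1 - ‖y‖) = ‖y‖ - ‖x‖ by ring, norm_sub_rev]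
      exact abs_norm_sub_norm_le y x
    refine h1.trans (max_le ?_ h2)
    simp

lemma bump_gag {N : ℕ} (hN0 : 0 < N) {s p : ℝ} (hs : 0 < s) (hs1 : s < 1) (hp : 1 < p) :
    gagliardoP N s p (bump N) < ⊤ := by
  have hp0 : 0 < p := by linarith
  obtain ⟨k, hk⟩ : ∃ k : Euc N → ℝ≥0∞,
    k = fun z => ENNReal.ofReal (min 1 ‖z‖ ^ p / ‖z‖ ^ ((N:ℝ) + s * p)) := ⟨_, rfl⟩
  have hkm : Measurable k := by rw [hk]; fun_prop
  have hkf : ∫⁻ z, k z < ⊤ := by rw [hk]; exact farK_fin hN0 hs hs1 hp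
  obtain ⟨g, hg⟩ : ∃ g : Euc N → ℝ≥0∞, g = (Metric.ball (0 : Euc N) 1).indicator 1 := ⟨_, rfl⟩
  have hgm : Measurable g := by rw [hg]; exact measurable_one.indicator measurableSet_ball
  have hgf : ∫⁻ z, g z < ⊤ := by
    rw [hg, lintegral_indicator_one measurableSet_ball]; exact measure_ball_lt_top
  have hg1 : ∀ x, g x ≠ ⊤ := by
    intro x; rw [hg]; simp only [Set.indicator]; split_ifs <;> simp
  have hb : ∀ x y, ENNReal.ofReal (|bump N x - bump N y| ^ p / ‖x - y‖ ^ ((N : ℝ) + s * p)) ≤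
      g x * k (x - y) + g y * k (x - y) := by
    intro x y
    have h0 : ENNReal.ofReal (|bump N x - bump N y| ^ p / ‖x - y‖ ^ ((N : ℝ) + s * p)) ≤
        k (x - y) := by
      rw [hk]
      refine ENNReal.ofReal_le_ofReal ?_
      have := bump_lip x y
      gcongr
    by_cases hx : x ∈ Metric.ball (0 : Euc N) 1
    · have : g x = 1 := by rw [hg, Set.indicator_of_mem hx]; rfl
      rw [this, one_mul]; exact h0.trans le_self_add
    by_cases hy : y ∈ Metric.ball (0 : Euc N) 1
    · have : g y = 1 := by rw [hg, Set.indicator_of_mem hy]; rfl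
      rw [this, one_mul]; exact h0.trans le_add_self
    rw [bump_zero hx, bump_zero hy, sub_zero, abs_zero, Real.zero_rpow hp0.ne', zero_div]
    simp
  unfold gagliardoP
  refine (lintegral_mono fun x => lintegral_mono fun y => hb x y).trans_lt ?_
  have e1 : ∀ x, ∫⁻ y, (g x * k (x - y) + g y * k (x - y)) =
      g x * (∫⁻ z, k z) + ∫⁻ y, g y * k (x - y) := by
    intro x
    rw [lintegral_add_left (by fun_prop), lintegral_const_mul' _ _ (hg1 x),
      lintegral_sub_left_eq_self k x]
  simp_rw [e1]
  rw [lintegral_add_left (by fun_prop), lintegral_mul_const' _ _ hkf.ne,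
    lintegral_lintegral_swap (by
      apply Measurable.aemeasurable
      unfold Function.uncurry
      fun_prop)]
  have e2 : ∀ y, ∫⁻ x, g y * k (x - y) = g y * ∫⁻ z, k z := by
    intro y
    rw [lintegral_const_mul' _ _ (hg1 y), lintegral_sub_right_eq_self k y]
  simp_rw [e2]
  rw [lintegral_mul_const' _ _ hkf.ne]
  exact ENNReal.add_lt_top.2 ⟨ENNReal.mul_lt_top hgf hkf, ENNReal.mul_lt_top hgf hkf⟩

lemma bump_cpt (N : ℕ) : HasCompactSupport (bump N) :=
  HasCompactSupport.intro (isCompact_closedBall (0 : Euc N) 1) fun x hx =>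
    bump_zero fun h => hx (Metric.ball_subset_closedBall h)

lemma bump_V {N : ℕ} {p : ℝ} (hp : 0 < p) (W : Euc N → ℝ) (hW : Continuous W)
    (hW0 : ∀ x, 0 ≤ W x) :
    ∫⁻ x, ENNReal.ofReal (W x * |bump N x| ^ p) < ⊤ := by
  have hc : Continuous (fun x => W x * |bump N x| ^ p) :=
    hW.mul ((bump_cont N).abs.rpow_const fun x => Or.inr hp.le)
  have hs : HasCompactSupport (fun x => W x * |bump N x| ^ p) :=
    HasCompactSupport.intro (isCompact_closedBall (0 : Euc N) 1) fun x hx => by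
      rw [bump_zero fun h => hx (Metric.ball_subset_closedBall h), abs_zero,
        Real.zero_rpow hp.ne', mul_zero]
  have := (hc.integrable_of_hasCompactSupport (μ := volume) hs).2
  rwa [hasFiniteIntegral_iff_ofReal (ae_of_all _ fun x => by
    have := hW0 x
    simp only [Pi.zero_apply]
    positivity)] at this

lemma bump_half {N : ℕ} {x : Euc N} (hx : x ∈ Metric.ball (0 : Euc N) (1/2)) :
    1 / 2 ≤ bump N x := by
  rw [mem_ball_zero_iff] at hx
  exact le_max_of_le_right (by linarith)

lemma norm_smul_eq {N : ℕ} {s p ε : ℝ} (V : Euc N → ℝ) (u : Euc N → ℝ) {T : ℝ} (hT : 0 ≤ T) :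
    normEpsP N s p ε V (fun x => T * u x) = ENNReal.ofReal (T ^ p) * normEpsP N s p ε V u := by
  have hTp : 0 ≤ T ^ p := by positivity
  unfold normEpsP gagliardoP
  rw [mul_add]
  congr 1
  · rw [← lintegral_const_mul' _ _ ENNReal.ofReal_ne_top]
    refine lintegral_congr fun x => ?_
    rw [← lintegral_const_mul' _ _ ENNReal.ofReal_ne_top]
    refine lintegral_congr fun y => ?_
    rw [← ENNReal.ofReal_mul hTp, ← mul_sub, abs_mul, abs_of_nonneg hT,
      Real.mul_rpow hT (abs_nonneg _), mul_div_assoc]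
  · rw [← lintegral_const_mul' _ _ ENNReal.ofReal_ne_top]
    refine lintegral_congr fun x => ?_
    rw [← ENNReal.ofReal_mul hTp, abs_mul, abs_of_nonneg hT,
      Real.mul_rpow hT (abs_nonneg _)]
    congr 1; ring

lemma norm_bump_pos {N : ℕ} {s p ε V₀ : ℝ} (hp : 0 < p) (V : Euc N → ℝ) (hV₀ : 0 < V₀)
    (hV : ∀ x, V₀ ≤ V x) : 0 < normEpsP N s p ε V (bump N) := by
  unfold normEpsP
  refine lt_of_lt_of_le ?_ le_add_self
  have h : ∫⁻ x in Metric.ball (0 : Euc N) (1/2), ENNReal.ofReal (V₀ * (1/2) ^ p) ≤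
      ∫⁻ x : Euc N, ENNReal.ofReal (V (ε • x) * |bump N x| ^ p) := by
    refine (setLIntegral_mono' measurableSet_ball fun x hx => ?_).trans (setLIntegral_le_lintegral _ _)
    refine ENNReal.ofReal_le_ofReal ?_
    rw [abs_of_nonneg (bump_nonneg x)]
    have h1 := bump_half hx
    have h2 := hV (ε • x)
    have h3 : 0 ≤ V (ε • x) := hV₀.le.trans h2
    gcongr
  refine lt_of_lt_of_le ?_ h
  rw [setLIntegral_const]
  exact ENNReal.mul_pos (by simpa using by positivity) (Metric.measure_ball_pos _ _ (by norm_num)).ne'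

/-- Mountain pass geometry (Lemma 3.1): (i) `J_ε(u) ≥ α` on the sphere `‖u‖_ε = ρ`;
(ii) there is `e` with `‖e‖_ε > ρ` and `J_ε(e) < 0`. -/
theorem stmt_7 {N : ℕ} {s p : ℝ} (hs0 : 0 < s) (hs1 : s < 1) (hp : 1 < p)
    (hN : s * p < (N : ℝ))
    (μ : ℝ) (hμ0 : 0 < μ) (hμ : μ < s * p)
    (V : Euc N → ℝ) (hVc : Continuous V)
    (V₀ : ℝ) (hV₀ : 0 < V₀) (hVlb : ∀ x, V₀ ≤ V x)
    (f : ℝ → ℝ) (hfc : Continuous f) (hf0 : ∀ t ≤ (0 : ℝ), f t = 0)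
    (q₁ q₂ C : ℝ) (hq₁ : p < q₁) (hq₁₂ : q₁ ≤ q₂)
    (hq₂ : q₂ < p * ((N : ℝ) - μ) / ((N : ℝ) - s * p)) (hCpos : 0 < C)
    (hf1 : ∀ t : ℝ, |f t| ≤ C * (|t| ^ (q₁ - 1) + |t| ^ (q₂ - 1)))
    (θ : ℝ) (hθ : p < θ)
    (hf2 : ∀ t : ℝ, 0 < t → 0 < θ * Ffun f t ∧ θ * Ffun f t ≤ 2 * f t * t)
    (hf3 : StrictMonoOn (fun t : ℝ => f t / t ^ (p / 2 - 1)) (Set.Ioi 0))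
    (ε : ℝ) (hε : 0 < ε) :
    ∃ α : ℝ, 0 < α ∧ ∃ ρ : ℝ, 0 < ρ ∧
      (∀ u : Euc N → ℝ, normEpsP N s p ε V u = ENNReal.ofReal (ρ ^ p) →
        α ≤ Jfun N s p ε μ V f u) ∧
      (∃ e : Euc N → ℝ, normEpsP N s p ε V e < ⊤ ∧
        ENNReal.ofReal (ρ ^ p) < normEpsP N s p ε V e ∧
        Jfun N s p ε μ V f e < 0) := by
  have hp0 : 0 < p := by linarith
  have hsp : 0 < s * p := by positivity
  have hNR : (0:ℝ) < N := by linarith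
  have hN0 : 0 < N := by exact_mod_cast hNR
  have hNsp : 0 < (N:ℝ) - s * p := by linarith
  have hθ0 : 0 < θ := by linarith
  have hq₂0 : 0 < q₂ := by linarith
  obtain ⟨r, hrdef⟩ : ∃ r, r = (N:ℝ) * p / ((N:ℝ) - s * p) := ⟨_, rfl⟩
  have hr : p + r * (s * p / N) = r := by
    have h1 := hNsp.ne'
    have h2 : r * ((N:ℝ) - s * p) = N * p := by rw [hrdef, div_mul_cancel₀ _ h1]
    field_simp
    linarith
  have hr0 : 0 < r := by rw [hrdef]; positivity
  have hcond : q₂ * N < r * (N - μ) := by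
    have : r * (N - μ) = (p * ((N : ℝ) - μ) / ((N : ℝ) - s * p)) * N := by
      rw [hrdef]; field_simp
    rw [this]
    exact mul_lt_mul_of_pos_right hq₂ hNR
  have hq₂r : q₂ < r := by nlinarith
  obtain ⟨t, htdef⟩ : ∃ t, t = r / q₂ := ⟨_, rfl⟩
  have ht : 1 < t := by rw [htdef, lt_div_iff₀ hq₂0]; linarith
  have hqt : q₂ * t ≤ r := by rw [htdef]; field_simp; exact le_rfl
  have hm : μ * (t / (t - 1)) < N := by
    rw [← mul_div_assoc, div_lt_iff₀ (by linarith)]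
    have : N < t * (N - μ) := by
      rw [htdef, div_mul_eq_mul_div, lt_div_iff₀ hq₂0]; linarith
    linarith
  have hFnn : ∀ τ, 0 ≤ Ffun f τ := by
    intro τ
    rcases le_or_gt τ 0 with h | h
    · rw [F_nonpos hf0 h]
    · exact (pos_of_mul_pos_right (hf2 τ h).1 hθ0.le).le
  have hFb : ∀ {τ : ℝ}, 0 ≤ τ → Ffun f τ ≤ C * (τ ^ q₁ + τ ^ q₂) := fun h =>
    F_bound hCpos (by linarith) (by linarith) hf1 h
  obtain ⟨B, hB, hSob⟩ := sobolev_s7 hN0 hs0 hp (by linarith : p ≤ r) hr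
  obtain ⟨κ, hκ, hconv⟩ := conv_bound hN0 hp0 hq₁.le hq₁₂ ht hqt hμ0 hCpos.le hm
  obtain ⟨A, hA⟩ : ∃ A, A = 1 / V₀ := ⟨_, rfl⟩
  have hA0 : 0 < A := by rw [hA]; positivity
  obtain ⟨D, hD⟩ : ∃ D, D = (1 / 2) * ((2 * C * (A + B + κ)) * (2 * C * (A + B))) := ⟨_, rfl⟩
  have hD0 : 0 < D := by rw [hD]; positivity
  obtain ⟨ρ, hρdef⟩ : ∃ ρ, ρ = min 1 ((1 / (2 * p * D)) ^ (1 / (q₁ - p))) := ⟨_, rfl⟩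
  have hρ0 : 0 < ρ := by rw [hρdef]; exact lt_min one_pos (by positivity)
  have hρ1 : ρ ≤ 1 := by rw [hρdef]; exact min_le_left _ _
  have hρD : D * ρ ^ q₁ ≤ ρ ^ p / (2 * p) := by
    have h1 : ρ ^ (q₁ - p) ≤ 1 / (2 * p * D) := by
      have h2 : ρ ≤ (1 / (2 * p * D)) ^ (1 / (q₁ - p)) := by rw [hρdef]; exact min_le_right _ _
      have h3 := Real.rpow_le_rpow hρ0.le h2 (show 0 ≤ q₁ - p by linarith)
      rwa [← Real.rpow_mul (by positivity), one_div_mul_cancel (by linarith), Real.rpow_one] at h3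
    rw [Real.rpow_sub hρ0, div_le_div_iff₀ (by positivity) (by positivity)] at h1
    rw [le_div_iff₀ (by positivity)]
    linarith
  refine ⟨ρ ^ p / (2 * p), by positivity, ρ, hρ0, ?_, ?_⟩
  · intro u hu
    have hρp : 0 ≤ ρ ^ p := by positivity
    unfold Jfun
    rw [hu, ENNReal.toReal_ofReal hρp]
    suffices h : SigmaFun N μ f u ≤ D * ρ ^ q₁ by
      have : ρ ^ p / (2 * p) + ρ ^ p / (2 * p) = 1 / p * ρ ^ p := by field_simp; ring
      linarith
    unfold SigmaFun
    by_cases hmeas : AEMeasurable (fun x => Ffun f (u x)) volume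
    swap
    · rw [sigma_zero hN0 (fun x => Ffun f (u x)) hmeas, mul_zero]; positivity
    have hvm := F_aemeas hfc hf0 hf2 u hmeas
    have hvn : ∀ x, 0 ≤ max (u x) 0 := fun x => le_max_right _ _
    have hG : gagliardoP N s p (fun x => max (u x) 0) ≤ ENNReal.ofReal (ρ ^ p) := by
      rw [← hu]
      refine (gag_mono hp0.le u _ fun x y => ?_).trans le_self_add
      simpa using abs_max_sub_max_le_max (u x) 0 (u y) 0
    have hL : ∫⁻ y, ENNReal.ofReal (max (u y) 0 ^ p) ≤ ENNReal.ofReal (A * ρ ^ p) := by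
      rw [ENNReal.ofReal_mul hA0.le, ← hu]
      have h1 : ∫⁻ y, ENNReal.ofReal (max (u y) 0 ^ p) ≤
          ∫⁻ y, ENNReal.ofReal A * ENNReal.ofReal (V (ε • y) * |u y| ^ p) := by
        refine lintegral_mono fun y => ?_
        rw [← ENNReal.ofReal_mul hA0.le]
        refine ENNReal.ofReal_le_ofReal ?_
        have h2 : max (u y) 0 ^ p ≤ |u y| ^ p :=
          Real.rpow_le_rpow (hvn y) (max_le (le_abs_self _) (abs_nonneg _)) hp0.le
        have h3 : 1 ≤ A * V (ε • y) := by
          rw [hA, one_div_mul_eq_div, le_div_iff₀ hV₀, one_mul]; exact hVlb _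
        have h4 : 0 ≤ |u y| ^ p := by positivity
        nlinarith
      refine h1.trans ?_
      rw [lintegral_const_mul' _ _ ENNReal.ofReal_ne_top]
      exact mul_le_mul_right le_add_self _
    have hR : ∫⁻ y, ENNReal.ofReal (max (u y) 0 ^ r) ≤ ENNReal.ofReal (B * ρ ^ r) := by
      have h1 := hSob _ hvn hvm (hL.trans_lt ENNReal.ofReal_lt_top) (ρ ^ p) hρp hG
      rwa [← Real.rpow_mul hρ0.le, mul_div_cancel₀ _ hp0.ne'] at h1
    have hI1 := interp hp0 hq₁.le (hq₁₂.trans hq₂r.le) hρ0 hA0.le hB.le _ hvn hvm hL hR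
    have hI2 := interp hp0 (hq₁.le.trans hq₁₂) hq₂r.le hρ0 hA0.le hB.le _ hvn hvm hL hR
    have hwb : ∀ x, Ffun f (u x) ≤ C * (max (u x) 0 ^ q₁ + max (u x) 0 ^ q₂) := by
      intro x
      rw [F_max hf0]
      exact hFb (hvn x)
    have hK := hconv _ (fun x => Ffun f (u x)) A B hA0.le hB.le hvn hvm hwb
      (hL.trans (ENNReal.ofReal_le_ofReal
        (mul_le_of_le_one_right hA0.le (Real.rpow_le_one hρ0.le hρ1 hp0.le))))
      (hR.trans (ENNReal.ofReal_le_ofReal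
        (mul_le_of_le_one_right hB.le (Real.rpow_le_one hρ0.le hρ1 hr0.le))))
    have hW : ∫⁻ y, ENNReal.ofReal (Ffun f (u y)) ≤
        ENNReal.ofReal ((2 * C * (A + B)) * ρ ^ q₁) := by
      calc ∫⁻ y, ENNReal.ofReal (Ffun f (u y))
          ≤ ∫⁻ y, ENNReal.ofReal C * (ENNReal.ofReal (max (u y) 0 ^ q₁) +
              ENNReal.ofReal (max (u y) 0 ^ q₂)) := by
            refine lintegral_mono fun y => ?_
            have := hvn y
            rw [← ENNReal.ofReal_add (by positivity) (by positivity),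
              ← ENNReal.ofReal_mul hCpos.le]
            exact ENNReal.ofReal_le_ofReal (hwb y)
        _ ≤ ENNReal.ofReal C * (ENNReal.ofReal ((A + B) * ρ ^ q₁) +
              ENNReal.ofReal ((A + B) * ρ ^ q₂)) := by
            rw [lintegral_const_mul' _ _ ENNReal.ofReal_ne_top, lintegral_add_left' (by fun_prop)]
            exact mul_le_mul_right (add_le_add hI1 hI2) _
        _ ≤ _ := by
            rw [← ENNReal.ofReal_add (by positivity) (by positivity),
              ← ENNReal.ofReal_mul hCpos.le]
            refine ENNReal.ofReal_le_ofReal ?_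
            have h1 : ρ ^ q₂ ≤ ρ ^ q₁ := Real.rpow_le_rpow_of_exponent_ge hρ0 hρ1 hq₁₂
            have h2 : C * ((A + B) * ρ ^ q₁ + (A + B) * ρ ^ q₂) ≤
                C * ((A + B) * ρ ^ q₁ + (A + B) * ρ ^ q₁) := by gcongr
            linarith
    have hfinal := sigma_le (fun x => Ffun f (u x)) (fun x => hFnn _) (by positivity)
      (by positivity) hK hW
    rw [hD]
    linarith
  · -- part (ii)
    have hVc' : Continuous fun x : Euc N => V (ε • x) := hVc.comp (continuous_const_smul ε)
    have hVn : ∀ x : Euc N, 0 ≤ V (ε • x) := fun x => hV₀.le.trans (hVlb _)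
    have hnfin : normEpsP N s p ε V (bump N) < ⊤ :=
      ENNReal.add_lt_top.2 ⟨bump_gag hN0 hs0 hs1 hp, bump_V hp0 _ hVc' hVn⟩
    have hnpos := norm_bump_pos (s := s) (ε := ε) hp0 V hV₀ hVlb
    obtain ⟨n, hn⟩ : ∃ n, n = (normEpsP N s p ε V (bump N)).toReal := ⟨_, rfl⟩
    have hn0 : 0 < n := by rw [hn]; exact ENNReal.toReal_pos hnpos.ne' hnfin.ne
    have hne : normEpsP N s p ε V (bump N) = ENNReal.ofReal n := by
      rw [hn, ENNReal.ofReal_toReal hnfin.ne]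
    obtain ⟨c, hc⟩ : ∃ c, c = (1 / 2) * (Ffun f (1/2) ^ 2 *
      (volume.real (Metric.ball (0 : Euc N) (1/2))) ^ 2) := ⟨_, rfl⟩
    have hFh : 0 < Ffun f (1/2) := pos_of_mul_pos_right (hf2 (1/2) (by norm_num)).1 hθ0.le
    have hvol : 0 < volume.real (Metric.ball (0 : Euc N) (1/2)) :=
      ENNReal.toReal_pos (Metric.measure_ball_pos _ _ (by norm_num)).ne' measure_ball_lt_top.ne
    have hc0 : 0 < c := by rw [hc]; positivity
    have hmonoF := (F_strict hfc hf2).monotoneOn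
    have hSig : ∀ T : ℝ, 1 ≤ T → T ^ θ * c ≤ SigmaFun N μ f (fun x => T * bump N x) := by
      intro T hT
      have hT0 : 0 < T := by linarith
      have hvn : ∀ x, 0 ≤ T * bump N x := fun x => mul_nonneg hT0.le (bump_nonneg x)
      have hvc : Continuous fun x => T * bump N x := continuous_const.mul (bump_cont N)
      have hpow : ∀ q : ℝ, 0 < q → ∫⁻ x, ENNReal.ofReal ((T * bump N x) ^ q) < ⊤ := by
        intro q hq
        have := bump_V (N := N) hq (fun _ => T ^ q) continuous_const (fun _ => by positivity)
        refine lt_of_eq_of_lt (lintegral_congr fun x => ?_) this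
        rw [Real.mul_rpow hT0.le (bump_nonneg x), abs_of_nonneg (bump_nonneg x)]
      have hK := hconv (fun x => T * bump N x) (fun x => Ffun f (T * bump N x)) _ _
        ENNReal.toReal_nonneg ENNReal.toReal_nonneg hvn hvc.aemeasurable (fun x => hFb (hvn x))
        (ENNReal.ofReal_toReal (hpow p hp0).ne).ge (ENNReal.ofReal_toReal (hpow r hr0).ne).ge
      have hWfin : ∫⁻ y, ENNReal.ofReal (Ffun f (T * bump N y)) < ⊤ := by
        have hb : ∀ y, ENNReal.ofReal (Ffun f (T * bump N y)) ≤
            ENNReal.ofReal C * (ENNReal.ofReal ((T * bump N y) ^ q₁) +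
              ENNReal.ofReal ((T * bump N y) ^ q₂)) := by
          intro y
          have := hvn y
          rw [← ENNReal.ofReal_add (by positivity) (by positivity),
              ← ENNReal.ofReal_mul hCpos.le]
          exact ENNReal.ofReal_le_ofReal (hFb this)
        refine (lintegral_mono hb).trans_lt ?_
        have hm1 := hvc.measurable
        rw [lintegral_const_mul' _ _ ENNReal.ofReal_ne_top, lintegral_add_left (by fun_prop)]
        exact ENNReal.mul_lt_top ENNReal.ofReal_lt_top
          (ENNReal.add_lt_top.2 ⟨hpow q₁ (by linarith), hpow q₂ hq₂0⟩)
      have hge := sigma_ge hN0 hμ0 (fun x => Ffun f (T * bump N x)) (fun x => hFnn _)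
        ((F_cont hfc).comp hvc).measurable (by positivity) hK
        (ENNReal.ofReal_toReal hWfin.ne).ge (c := T ^ (θ / 2) * Ffun f (1/2)) (by positivity) (by
          intro x hx
          refine (F_growth hfc hf2 hT (by norm_num)).trans ?_
          refine hmonoF (Set.mem_Ici.2 (by positivity)) (Set.mem_Ici.2 (hvn x)) ?_
          exact mul_le_mul_of_nonneg_left (bump_half hx) hT0.le)
      unfold SigmaFun
      have hTT : T ^ θ = (T ^ (θ / 2)) ^ 2 := by
        rw [← Real.rpow_natCast, ← Real.rpow_mul hT0.le]; congr 1; push_cast; ring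
      rw [hc, hTT]
      rw [mul_pow] at hge
      linarith
    have hlim1 : Tendsto (fun T : ℝ => T ^ p * n) atTop atTop :=
      (tendsto_rpow_atTop hp0).atTop_mul_const hn0
    have hlim2 : Tendsto (fun T : ℝ => T ^ (θ - p) * c) atTop atTop :=
      (tendsto_rpow_atTop (by linarith)).atTop_mul_const hc0
    obtain ⟨T, hT1, hT2, hT3⟩ := ((hlim1.eventually_gt_atTop (ρ ^ p)).and
      ((hlim2.eventually_gt_atTop (1 / p * n)).and (eventually_ge_atTop 1))).exists
    have hT0 : 0 < T := by linarith
    have hTp : 0 < T ^ p := by positivity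
    have hnorm : normEpsP N s p ε V (fun x => T * bump N x) = ENNReal.ofReal (T ^ p * n) := by
      rw [norm_smul_eq V _ hT0.le, hne, ENNReal.ofReal_mul hTp.le]
    refine ⟨fun x => T * bump N x, ?_, ?_, ?_⟩
    · rw [hnorm]; exact ENNReal.ofReal_lt_top
    · rw [hnorm]; exact (ENNReal.ofReal_lt_ofReal_iff (by positivity)).2 hT1
    · unfold Jfun
      rw [hnorm, ENNReal.toReal_ofReal (by positivity)]
      have h1 := hSig T hT3
      have h2 : T ^ θ = T ^ p * T ^ (θ - p) := by
        rw [← Real.rpow_add hT0]; congr 1; ring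
      have h3 : T ^ p * (1 / p * n) < T ^ p * (T ^ (θ - p) * c) :=
        mul_lt_mul_of_pos_left hT2 hTp
      rw [h2] at h1
      linarith
end
end

section
/- Let s ∈ (0,1), p ∈ (1,∞), N > sp, 0 < μ < sp, and let f satisfy (f1) with exponents p < q₁ ≤ q₂ < p(N−μ)/(N−sp). For every K > 0 there exists C₀ > 0 such that for every u ∈ W^{s,p}(ℝ^N) with ‖u‖_{s,p} ≤ K and every x ∈ ℝ^N, ∫_{ℝ^N} |F(u(y))|/|x−y|^μ dy ≤ C₀. -/
open MeasureTheory Filter Topology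
open scoped ENNReal

noncomputable section

lemma aux_level {N : ℕ} {s p : ℝ} (hs0 : 0 < s) (hp : 1 < p) (hN0 : 0 < N)
    {ω : ℝ} (hω : 0 < ω) (hω' : volume (Metric.ball (0 : Euc N) 1) = ENNReal.ofReal ω)
    {u : Euc N → ℝ} (hu : Measurable u) {G : ℝ} (hG : gagliardoP N s p u ≤ ENNReal.ofReal G)
    {l V : ℝ} (hl : 0 < l) (hV : 0 < V)
    (hE : volume {x | l / 2 < |u x|} ≤ ENNReal.ofReal V) :
    volume {x | l < |u x|} ≤
      ENNReal.ofReal (G / ((l / 2) ^ p / ((2 * V / ω) ^ ((1:ℝ) / N)) ^ ((N:ℝ) + s * p) * V)) := by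
  have hNr : (0:ℝ) < N := by exact_mod_cast hN0
  set r : ℝ := (2 * V / ω) ^ ((1:ℝ) / N) with hr
  have hr0 : 0 < r := by positivity
  have hrN : r ^ N * ω = 2 * V := by
    rw [hr, ← Real.rpow_natCast, ← Real.rpow_mul (by positivity)]
    rw [one_div, inv_mul_cancel₀ hNr.ne', Real.rpow_one]
    field_simp
  have hmeas : ∀ c : ℝ, MeasurableSet {x | c < |u x|} := fun c =>
    measurableSet_lt measurable_const hu.abs
  set c : ℝ := (l / 2) ^ p / r ^ ((N:ℝ) + s * p) with hc
  have hc0 : 0 < c := by positivity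
  have inner : ∀ x ∈ {x | l < |u x|}, ENNReal.ofReal (c * V) ≤
      ∫⁻ y : Euc N, ENNReal.ofReal (|u x - u y| ^ p / ‖x - y‖ ^ ((N : ℝ) + s * p)) := by
    intro x hx
    have hx : l < |u x| := hx
    have : Nonempty (Fin N) := ⟨⟨0, hN0⟩⟩
    set S := Metric.ball x r \ {x | l / 2 < |u x|} with hS
    have hSm : MeasurableSet S := Metric.isOpen_ball.measurableSet.diff (hmeas _)
    have hvol : ENNReal.ofReal V ≤ volume S := by
      refine le_trans ?_ le_measure_sdiff
      rw [Measure.addHaar_ball _ _ hr0.le, hω', finrank_euclideanSpace, Fintype.card_fin,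
        ← ENNReal.ofReal_mul (by positivity), hrN]
      calc ENNReal.ofReal V = ENNReal.ofReal (2 * V) - ENNReal.ofReal V := by
            rw [← ENNReal.ofReal_sub _ hV.le]; congr 1; ring
        _ ≤ _ := tsub_le_tsub_left hE _
    calc ENNReal.ofReal (c * V) = ENNReal.ofReal c * ENNReal.ofReal V :=
          ENNReal.ofReal_mul hc0.le
      _ ≤ ENNReal.ofReal c * volume S := by gcongr
      _ = ∫⁻ y in S, ENNReal.ofReal c := by rw [setLIntegral_const]
      _ ≤ ∫⁻ y in S, ENNReal.ofReal (|u x - u y| ^ p / ‖x - y‖ ^ ((N : ℝ) + s * p)) := by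
          refine setLIntegral_mono' hSm ?_
          rintro y ⟨hy1, hy2⟩
          have hy2 : |u y| ≤ l / 2 := not_lt.1 hy2
          apply ENNReal.ofReal_le_ofReal
          have h1 : l / 2 ≤ |u x - u y| := by
            have := abs_sub_abs_le_abs_sub (u x) (u y)
            linarith
          have hxy : 0 < ‖x - y‖ := by
            rw [norm_pos_iff, sub_ne_zero]
            rintro rfl
            linarith
          have h2 : ‖x - y‖ ≤ r := by
            rw [Metric.mem_ball, dist_comm, dist_eq_norm] at hy1
            exact hy1.le
          have : 0 ≤ s * p := by positivity
          rw [hc]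
          gcongr
      _ ≤ _ := setLIntegral_le_lintegral _ _
  have h1 : ENNReal.ofReal (c * V) * volume {x | l < |u x|} ≤ ENNReal.ofReal G := by
    refine le_trans ?_ hG
    rw [← setLIntegral_const]
    unfold gagliardoP
    exact (setLIntegral_mono' (hmeas _) inner).trans (setLIntegral_le_lintegral _ _)
  have hcV : 0 < c * V := by positivity
  rw [ENNReal.ofReal_div_of_pos hcV, ENNReal.le_div_iff_mul_le
    (Or.inl (by simpa using hcV)) (Or.inl ENNReal.ofReal_ne_top), mul_comm]
  exact h1

def qseq (p θ : ℝ) : ℕ → ℝ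
  | 0 => p
  | n + 1 => p + θ * qseq p θ n

lemma aux_iter {N : ℕ} {s p : ℝ} (hs0 : 0 < s) (hp : 1 < p) (hN0 : 0 < N)
    {K : ℝ} (hK : 0 < K) (n : ℕ) :
    ∃ M : ℝ, 0 < M ∧ ∀ u : Euc N → ℝ, Measurable u →
        gagliardoP N s p u + lpP N p u ≤ ENNReal.ofReal (K ^ p) → ∀ l : ℝ, 0 < l →
        volume {x | l < |u x|} ≤ ENNReal.ofReal (M * l ^ (- qseq p (s * p / N) n)) := by
  have hNr : (0:ℝ) < N := by exact_mod_cast hN0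
  induction n with
  | zero =>
    refine ⟨K ^ p, by positivity, fun u hu h l hl => ?_⟩
    have h2 : lpP N p u ≤ ENNReal.ofReal (K ^ p) := le_trans le_add_self h
    have hlp : 0 < l ^ p := by positivity
    have h3 : ENNReal.ofReal (l ^ p) * volume {x | l < |u x|} ≤ lpP N p u := by
      unfold lpP
      rw [← setLIntegral_const]
      refine (setLIntegral_mono' (measurableSet_lt measurable_const hu.abs) ?_).trans
        (setLIntegral_le_lintegral _ _)
      intro x hx
      have hx : l < |u x| := hx
      apply ENNReal.ofReal_le_ofReal
      gcongr
    rw [qseq, Real.rpow_neg hl.le, ← div_eq_mul_inv, ENNReal.ofReal_div_of_pos hlp,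
      ENNReal.le_div_iff_mul_le
      (Or.inl (by simpa using hlp)) (Or.inl ENNReal.ofReal_ne_top), mul_comm]
    exact h3.trans h2
  | succ n ih =>
    obtain ⟨M, hM, H⟩ := ih
    set q := qseq p (s * p / N) n with hq
    set ω : ℝ := (volume (Metric.ball (0 : Euc N) 1)).toReal with hωdef
    have hω' : volume (Metric.ball (0 : Euc N) 1) = ENNReal.ofReal ω :=
      (ENNReal.ofReal_toReal measure_ball_lt_top.ne).symm
    have hω : 0 < ω := ENNReal.toReal_pos (Metric.measure_ball_pos _ _ one_pos).ne'
      measure_ball_lt_top.ne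
    refine ⟨K ^ p * 2 ^ p * (2 / ω) ^ (1 + s * p / N) * (M * 2 ^ q) ^ (s * p / N),
      by positivity, fun u hu h l hl => ?_⟩
    have hV : 0 < M * (l / 2) ^ (-q) := by positivity
    refine (aux_level hs0 hp hN0 hω hω' hu (le_trans le_self_add h) hl hV
      (H u hu h (l/2) (by positivity))).trans (le_of_eq ?_)
    congr 1
    rw [qseq, ← hq]
    have e1 : (M * (l / 2) ^ (-q)) = M * 2 ^ q * l ^ (-q) := by
      rw [Real.div_rpow hl.le (by norm_num), Real.rpow_neg (by norm_num : (0:ℝ) ≤ 2)]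
      field_simp
    set A := M * 2 ^ q with hA
    have hA0 : 0 < A := by positivity
    have e3 : l ^ (-q) = (l ^ (-q)) ^ (1:ℝ) := by simp
    rw [e1, ← Real.rpow_mul (by positivity)]
    have e2 : (1:ℝ) / N * (N + s * p) = 1 + s * p / N := by field_simp
    rw [e2, show 2 * (A * l ^ (-q)) / ω = (2 / ω) * (A * l ^ (-q)) by ring,
      Real.mul_rpow (by positivity) (by positivity)]
    rw [Real.rpow_add (by positivity) 1 (s * p / N) (x := A * l ^ (-q)), Real.rpow_one,
      Real.mul_rpow hA0.le (by positivity), ← Real.rpow_mul hl.le,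
      Real.div_rpow hl.le (by norm_num), neg_add, Real.rpow_add hl, Real.rpow_neg hl.le p,
      show -q * (s * p / N) = -(s * p / N * q) by ring]
    have : 0 < l ^ (-q) := by positivity
    field_simp

lemma qseq_tendsto {p θ : ℝ} (h0 : 0 ≤ θ) (h1 : θ < 1) :
    Tendsto (qseq p θ) atTop (𝓝 (p / (1 - θ))) := by
  have h : ∀ n, qseq p θ n = p / (1 - θ) - θ ^ n * (θ * p / (1 - θ)) := by
    have : 1 - θ ≠ 0 := by linarith
    intro n
    induction n with
    | zero => rw [qseq]; field_simp
    | succ n ih => rw [qseq, ih]; field_simp; ring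
  have h2 := (tendsto_pow_atTop_nhds_zero_of_lt_one h0 h1).mul_const (θ * p / (1 - θ))
  have h3 := h2.const_sub (p / (1 - θ))
  simp only [zero_mul, sub_zero] at h3
  exact h3.congr (fun n => (h n).symm)

lemma aux_embed {N : ℕ} {s p : ℝ} (hs0 : 0 < s) (hp : 1 < p) (hN : s * p < (N : ℝ))
    {K : ℝ} (hK : 0 < K) {r : ℝ} (hr : p < r) (hr' : r < p * N / (N - s * p)) :
    ∃ B : ℝ≥0∞, B ≠ ⊤ ∧ ∀ u : Euc N → ℝ, Measurable u →
        gagliardoP N s p u + lpP N p u ≤ ENNReal.ofReal (K ^ p) →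
        ∫⁻ x, ENNReal.ofReal (|u x| ^ r) ≤ B := by
  have hNr : (0:ℝ) < N := lt_trans (by positivity) hN
  have hN0 : 0 < N := by exact_mod_cast hNr
  have hθ : s * p / N < 1 := by rwa [div_lt_one hNr]
  have hlim : p / (1 - s * p / N) = p * N / (N - s * p) := by
    have : (N:ℝ) - s * p ≠ 0 := by linarith
    have : 1 - s * p / N ≠ 0 := by linarith
    field_simp
  have ht := qseq_tendsto (p := p) (θ := s * p / N) (by positivity) hθ
  rw [hlim] at ht
  obtain ⟨n, hn⟩ := (ht.eventually (lt_mem_nhds hr')).exists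
  obtain ⟨M0, hM0, H0⟩ := aux_iter (s := s) hs0 hp hN0 hK 0
  obtain ⟨M, hM, H⟩ := aux_iter (s := s) hs0 hp hN0 hK n
  set q := qseq p (s * p / N) n with hq
  have i1 : IntegrableOn (fun t : ℝ => M0 * t ^ (r - 1 - p)) (Set.Ioc 0 1) := by
    have := (intervalIntegral.intervalIntegrable_rpow' (a := 0) (b := 1)
      (show -1 < r - 1 - p by linarith)).const_mul M0
    rwa [intervalIntegrable_iff_integrableOn_Ioc_of_le zero_le_one] at this
  have i2 : IntegrableOn (fun t : ℝ => M * t ^ (r - 1 - q)) (Set.Ioi 1) :=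
    (integrableOn_Ioi_rpow_of_lt (by linarith) one_pos).const_mul M
  refine ⟨ENNReal.ofReal r * ((∫⁻ t in Set.Ioc (0:ℝ) 1, ENNReal.ofReal (M0 * t ^ (r - 1 - p))) +
    ∫⁻ t in Set.Ioi (1:ℝ), ENNReal.ofReal (M * t ^ (r - 1 - q))), ?_, ?_⟩
  · exact ENNReal.mul_ne_top ENNReal.ofReal_ne_top
      (ENNReal.add_ne_top.2 ⟨i1.lintegral_lt_top.ne, i2.lintegral_lt_top.ne⟩)
  · intro u hu h
    rw [lintegral_rpow_eq_lintegral_meas_lt_mul volume (Eventually.of_forall fun x => abs_nonneg _)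
      hu.abs.aemeasurable (by linarith : 0 < r)]
    gcongr
    rw [← Set.Ioc_union_Ioi_eq_Ioi (zero_le_one : (0:ℝ) ≤ 1)]
    refine (lintegral_union_le _ _ _).trans ?_
    gcongr ?_ + ?_
    · refine setLIntegral_mono' measurableSet_Ioc fun t ht => ?_
      have ht0 : 0 < t := ht.1
      refine (mul_le_mul_left (H0 u hu h t ht0) _).trans (le_of_eq ?_)
      rw [← ENNReal.ofReal_mul (by positivity), qseq, mul_assoc, ← Real.rpow_add ht0]
      congr 3; ring
    · refine setLIntegral_mono' measurableSet_Ioi fun t ht => ?_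
      have ht0 : 0 < t := zero_lt_one.trans ht
      refine (mul_le_mul_left (H u hu h t ht0) _).trans (le_of_eq ?_)
      rw [← ENNReal.ofReal_mul (by positivity), mul_assoc, ← Real.rpow_add ht0]
      congr 3; ring

lemma aux_pow_le {a p b r : ℝ} (ha : 0 ≤ a) (hp : 0 < p) (h1 : p ≤ b) (h2 : b ≤ r) :
    a ^ b ≤ a ^ p + a ^ r := by
  have hp' : 0 ≤ a ^ p := Real.rpow_nonneg ha _
  have hr' : 0 ≤ a ^ r := Real.rpow_nonneg ha _
  rcases le_total a 1 with h | h
  · have := Real.rpow_le_rpow_of_exponent_ge' ha h hp.le h1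
    linarith
  · have := Real.rpow_le_rpow_of_exponent_le h h2
    linarith

lemma aux_ball {N : ℕ} (hN0 : 0 < N) {α : ℝ} (hα : α < N) :
    ∫⁻ z in Metric.ball (0 : Euc N) 1, ENNReal.ofReal (‖z‖ ^ (-α)) ≠ ⊤ := by
  have : Nonempty (Fin N) := ⟨⟨0, hN0⟩⟩
  have : IntegrableOn (fun z : Euc N => ‖z‖ ^ (-α)) (Metric.ball 0 1) volume := by
    rw [integrableOn_fun_norm_addHaar volume (f := fun t : ℝ => t ^ (-α)),
      finrank_euclideanSpace, Fintype.card_fin]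
    have h := (intervalIntegral.intervalIntegrable_rpow' (a := 0) (b := 1)
      (show -1 < (N:ℝ) - 1 - α by linarith))
    rw [intervalIntegrable_iff_integrableOn_Ioo_of_le zero_le_one] at h
    refine h.congr_fun (fun t ht => ?_) measurableSet_Ioo
    have ht0 : 0 < t := ht.1
    simp only [smul_eq_mul]
    rw [← Real.rpow_natCast, ← Real.rpow_add ht0, Nat.cast_sub hN0]
    congr 1
    push_cast; ring
  exact this.lintegral_lt_top.ne

lemma aux_F {f : ℝ → ℝ} {q₁ q₂ C : ℝ} (h1 : 1 < q₁) (h2 : 1 < q₂) (hC : 0 < C)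
    (hf1 : ∀ t : ℝ, |f t| ≤ C * (|t| ^ (q₁ - 1) + |t| ^ (q₂ - 1))) (t : ℝ) :
    |Ffun f t| ≤ C * (|t| ^ q₁ + |t| ^ q₂) := by
  have h := intervalIntegral.norm_integral_le_of_norm_le_const (a := 0) (b := t) (f := f)
    (C := C * (|t| ^ (q₁ - 1) + |t| ^ (q₂ - 1))) (fun x hx => by
      refine (hf1 x).trans ?_
      have hx' : |x| ≤ |t| := by
        rcases le_total 0 t with h | h
        · rw [Set.uIoc_of_le h] at hx
          rw [abs_of_pos hx.1, abs_of_nonneg h]; exact hx.2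
        · rw [Set.uIoc_of_ge h] at hx
          rw [abs_of_nonpos hx.2, abs_of_nonpos h]; linarith [hx.1]
      have : 0 ≤ q₁ - 1 := by linarith
      have : 0 ≤ q₂ - 1 := by linarith
      gcongr)
  unfold Ffun
  refine h.trans (le_of_eq ?_)
  rw [sub_zero]
  have e : ∀ q : ℝ, 1 < q → |t| ^ q = |t| ^ (q - 1) * |t| := by
    intro q hq
    rcases (abs_nonneg t).eq_or_lt with h | h
    · rw [← h, Real.zero_rpow (by linarith)]; simp
    · rw [← Real.rpow_add_one h.ne']; congr 1; ring
  rw [e q₁ h1, e q₂ h2]; ring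

/-- pointwise bound -/
lemma aux_pt {a d p b r τ τ' μ : ℝ} (ha : 0 ≤ a) (hd : 0 ≤ d) (hp : 0 < p) (hpb : p ≤ b)
    (hμ : 0 < μ) (hτ : τ.HolderConjugate τ') (hbr : b * τ ≤ r) :
    a ^ b / d ^ μ ≤ 2 * (a ^ p + a ^ r) + (if d < 1 then d ^ (-(μ * τ')) else 0) := by
  have hb : 0 < b := by linarith
  have hτ1 := hτ.lt
  have hbτ : b ≤ b * τ := by nlinarith
  have k1 := aux_pow_le ha hp hpb (hbτ.trans hbr)
  have k2 := aux_pow_le ha hp (hpb.trans hbτ) hbr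
  have k3 : 0 ≤ a ^ b := Real.rpow_nonneg ha _
  have k4 : 0 ≤ a ^ (b * τ) := Real.rpow_nonneg ha _
  split_ifs with h
  · have y := Real.young_inequality_of_nonneg k3 (Real.rpow_nonneg hd (-μ)) hτ
    rw [← Real.rpow_mul ha, ← Real.rpow_mul hd] at y
    have y1 : a ^ (b * τ) / τ ≤ a ^ (b * τ) := div_le_self k4 hτ1.le
    have y2 : d ^ (-μ * τ') / τ' ≤ d ^ (-μ * τ') :=
      div_le_self (Real.rpow_nonneg hd _) hτ.symm.lt.le
    rw [div_eq_mul_inv, ← Real.rpow_neg hd]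
    rw [neg_mul] at y y2
    linarith
  · have : 1 ≤ d ^ μ := Real.one_le_rpow (not_lt.1 h) hμ.le
    have := div_le_self k3 this
    linarith

theorem stmt_8 {N : ℕ} {s p : ℝ} (hs0 : 0 < s) (hs1 : s < 1) (hp : 1 < p)
    (hN : s * p < (N : ℝ))
    (μ : ℝ) (hμ0 : 0 < μ) (hμ : μ < s * p)
    (f : ℝ → ℝ) (hfc : Continuous f)
    (q₁ q₂ C : ℝ) (hq₁ : p < q₁) (hq₁₂ : q₁ ≤ q₂)
    (hq₂ : q₂ < p * ((N : ℝ) - μ) / ((N : ℝ) - s * p)) (hCpos : 0 < C)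
    (hf1 : ∀ t : ℝ, |f t| ≤ C * (|t| ^ (q₁ - 1) + |t| ^ (q₂ - 1))) :
    ∀ K : ℝ, 0 < K → ∃ C₀ : ℝ, 0 < C₀ ∧
      ∀ u : Euc N → ℝ, Measurable u →
        gagliardoP N s p u + lpP N p u ≤ ENNReal.ofReal (K ^ p) →
        ∀ x : Euc N,
          (∫⁻ y : Euc N, ENNReal.ofReal (|Ffun f (u y)| / ‖x - y‖ ^ μ)) ≤
            ENNReal.ofReal C₀ := by
  intro K hK
  have hNr : (0:ℝ) < N := lt_trans (by positivity) hN
  have hN0 : 0 < N := by exact_mod_cast hNr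
  have hNμ : 0 < (N:ℝ) - μ := by linarith
  have hNs : 0 < (N:ℝ) - s * p := by linarith
  have hq2 : 0 < q₂ := by linarith
  have hex : q₂ * N / (N - μ) < p * N / (N - s * p) := by
    rw [lt_div_iff₀ hNs] at hq₂
    rw [div_lt_div_iff₀ hNμ hNs]
    nlinarith
  obtain ⟨r, hr1, hr2⟩ := exists_between hex
  have hr1' : q₂ * N < r * (N - μ) := by rwa [div_lt_iff₀ hNμ] at hr1
  have hq2r : q₂ < r := by
    refine lt_trans ?_ hr1
    rw [lt_div_iff₀ hNμ]; nlinarith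
  have hr0 : 0 < r := by linarith
  have hτ1 : 1 < r / q₂ := by rwa [lt_div_iff₀ hq2, one_mul]
  have hτ := Real.HolderConjugate.conjExponent hτ1
  set τ := r / q₂ with hτd
  set τ' := τ.conjExponent with hτ'
  have hα : μ * τ' < N := by
    have e : τ' = r / (r - q₂) := by
      rw [hτ', Real.conjExponent, hτd]
      have : r - q₂ ≠ 0 := by linarith
      have : r / q₂ - 1 ≠ 0 := by linarith
      field_simp
    rw [e, ← mul_div_assoc, div_lt_iff₀ (by linarith)]
    nlinarith
  have hb2 : q₂ * τ ≤ r := le_of_eq (by rw [hτd]; field_simp)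
  have hb1 : q₁ * τ ≤ r := le_trans (by gcongr) hb2
  obtain ⟨B, hB, H⟩ := aux_embed hs0 hp hN hK (by linarith : p < r) hr2
  have hD := aux_ball hN0 hα
  set D := ∫⁻ z in Metric.ball (0 : Euc N) 1, ENNReal.ofReal (‖z‖ ^ (-(μ * τ'))) with hDd
  set T : ℝ≥0∞ := ENNReal.ofReal (4 * C) * (ENNReal.ofReal (K ^ p) + B) +
    ENNReal.ofReal (2 * C) * D with hT
  have hTtop : T ≠ ⊤ := by
    rw [hT]
    finiteness
  refine ⟨T.toReal + 1, by positivity, fun u hu h x => ?_⟩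
  have hlp : lpP N p u ≤ ENNReal.ofReal (K ^ p) := le_trans le_add_self h
  have hTle : T ≤ ENNReal.ofReal (T.toReal + 1) := by
    rw [ENNReal.le_ofReal_iff_toReal_le hTtop (by positivity)]
    linarith
  refine le_trans ?_ hTle
  have pt : ∀ y : Euc N, ENNReal.ofReal (|Ffun f (u y)| / ‖x - y‖ ^ μ) ≤
      ENNReal.ofReal (4 * C) * (ENNReal.ofReal (|u y| ^ p) + ENNReal.ofReal (|u y| ^ r)) +
      ENNReal.ofReal (2 * C) * (Metric.ball (0 : Euc N) 1).indicator
        (fun z => ENNReal.ofReal (‖z‖ ^ (-(μ * τ')))) (x - y) := by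
    intro y
    have e : (Metric.ball (0 : Euc N) 1).indicator
        (fun z => ENNReal.ofReal (‖z‖ ^ (-(μ * τ')))) (x - y) =
        ENNReal.ofReal (if ‖x - y‖ < 1 then ‖x - y‖ ^ (-(μ * τ')) else 0) := by
      simp only [Set.indicator, mem_ball_zero_iff]
      split_ifs <;> simp
    have hnn : 0 ≤ (if ‖x - y‖ < 1 then ‖x - y‖ ^ (-(μ * τ')) else 0) := by
      split_ifs <;> positivity
    rw [e, ← ENNReal.ofReal_add (by positivity) (by positivity),
      ← ENNReal.ofReal_mul (by positivity), ← ENNReal.ofReal_mul (by positivity),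
      ← ENNReal.ofReal_add (by positivity) (by positivity)]
    apply ENNReal.ofReal_le_ofReal
    have F := aux_F (by linarith) (by linarith) hCpos hf1 (u y)
    have p1 := aux_pt (abs_nonneg (u y)) (norm_nonneg (x - y)) (by linarith) hq₁.le hμ0 hτ hb1
    have p2 := aux_pt (abs_nonneg (u y)) (norm_nonneg (x - y)) (by linarith)
      (hq₁.le.trans hq₁₂) hμ0 hτ hb2
    calc |Ffun f (u y)| / ‖x - y‖ ^ μ ≤ C * (|u y| ^ q₁ + |u y| ^ q₂) / ‖x - y‖ ^ μ := by gcongr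
      _ = C * (|u y| ^ q₁ / ‖x - y‖ ^ μ + |u y| ^ q₂ / ‖x - y‖ ^ μ) := by ring
      _ ≤ _ := mul_le_mul_of_nonneg_left (add_le_add p1 p2) hCpos.le
      _ = _ := by ring
  have m1 : Measurable fun y => ENNReal.ofReal (|u y| ^ p) := by fun_prop
  have m2 : Measurable fun y => ENNReal.ofReal (|u y| ^ r) := by fun_prop
  refine (lintegral_mono pt).trans ?_
  rw [lintegral_add_left (by fun_prop), lintegral_const_mul _ (by fun_prop),
    lintegral_add_left m1, lintegral_const_mul' _ _ ENNReal.ofReal_ne_top,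
    lintegral_sub_left_eq_self (fun z => (Metric.ball (0 : Euc N) 1).indicator
        (fun z => ENNReal.ofReal (‖z‖ ^ (-(μ * τ')))) z) x,
    lintegral_indicator Metric.isOpen_ball.measurableSet]
  rw [hT]
  gcongr
  · exact hlp
  · exact H u hu h
end
end
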